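/- arXiv:2311.18767 — 3 statements merged into one kernel-verified Lean document; each statement's English description precedes it below -/
import Mathlib

section
/- Suppose f : 𝔻 → ℂ and g : 𝔻* → ℂ̂ are univalent (injective holomorphic) functions with f(0) = 0, g(∞) = ∞, and f(𝔻) ∩ g(𝔻*) = ∅. Then ∫_𝔻 |f'(z)/f(z) − 1/z|² d²z + ∫_{𝔻*} |g'(z)/g(z) − 1/z|² d²z ≤ 2π log |g'(∞)/f'(0)|, where g'(∞) = lim_{z→∞} g'(z). In particular |g'(∞)| ≥ |f'(0)|. -/
open Complex Metric Set MeasureTheory Filter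

/-- The exterior of the closed unit disk in `ℂ` (the finite part of `𝔻*`). -/
def extDisk : Set ℂ := {z : ℂ | 1 < ‖z‖}



theorem gr_deriv_ne_zero {f : ℂ → ℂ} {r : ℝ} (hr : 0 < r) (hf : DifferentiableOn ℂ f (ball (0:ℂ) r))
    (hfinj : InjOn f (ball (0:ℂ) r)) (hf0 : f 0 = 0) : deriv f 0 ≠ 0 := by
  intro hd
  have hball : ball (0:ℂ) r ∈ nhds (0:ℂ) := ball_mem_nhds _ hr
  have hfa : AnalyticAt ℂ f 0 := hf.analyticAt hball
  have hnz : ¬ (∀ᶠ z in nhds (0:ℂ), f z = 0) := by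
    intro h
    have h2 : ∀ᶠ z in nhdsWithin (0:ℂ) {0}ᶜ, f z = 0 ∧ z ∈ ball (0:ℂ) r ∧ z ≠ 0 :=
      ((h.and hball).filter_mono nhdsWithin_le_nhds).and self_mem_nhdsWithin |>.mono
        (fun z hz => ⟨hz.1.1, hz.1.2, hz.2⟩)
    obtain ⟨z, h1, h2, h3⟩ := h2.exists
    exact h3 (hfinj h2 (mem_ball_self hr) (by rw [h1, hf0]))
  obtain ⟨n, φ, hφ, hφ0, hφe⟩ := hfa.exists_eventuallyEq_pow_smul_nonzero_iff.2 hnz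
  simp only [sub_zero, smul_eq_mul] at hφe
  have hn0 : n ≠ 0 := by
    rintro rfl
    have := hφe.self_of_nhds
    simp [hf0] at this
    exact hφ0 this.symm
  have hn1 : n ≠ 1 := by
    rintro rfl
    have h1 : HasDerivAt f (φ 0) 0 := by
      have : HasDerivAt (fun z : ℂ => z ^ 1 * φ z) (1 * φ 0 + 0 * deriv φ 0) 0 := by
        simpa using (hasDerivAt_id' (0:ℂ)).fun_mul hφ.differentiableAt.hasDerivAt
      have h2 := this.congr_of_eventuallyEq hφe
      simpa using h2
    exact hφ0 (h1.deriv ▸ hd)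
  -- local root
  set ρ : ℂ → ℂ := fun z => z * Complex.exp (Complex.log (φ z / φ 0) / n) with hρ
  have hρd : HasStrictDerivAt ρ 1 0 := by
    have ha : AnalyticAt ℂ ρ 0 := by
      have h1 : AnalyticAt ℂ (fun z => φ z / φ 0) 0 := hφ.div analyticAt_const hφ0
      have h2 : AnalyticAt ℂ (fun z => Complex.log (φ z / φ 0)) 0 :=
        h1.clog (by simp [div_self hφ0])
      exact analyticAt_id.mul ((h2.div analyticAt_const (by exact_mod_cast hn0)).cexp)
    have h2 := ha.hasStrictDerivAt
    have h3 : deriv ρ 0 = 1 := by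
      have hc : AnalyticAt ℂ (fun z => Complex.exp (Complex.log (φ z / φ 0) / n)) 0 := by
        have h1 : AnalyticAt ℂ (fun z => φ z / φ 0) 0 := hφ.div analyticAt_const hφ0
        have h2 : AnalyticAt ℂ (fun z => Complex.log (φ z / φ 0)) 0 :=
          h1.clog (by simp [div_self hφ0])
        exact ((h2.div analyticAt_const (by exact_mod_cast hn0)).cexp)
      have := ((hasDerivAt_id (0:ℂ)).mul hc.differentiableAt.hasDerivAt).deriv
      simp [div_self hφ0] at this
      exact this
    rwa [h3] at h2
  have hmap : map ρ (nhds 0) = nhds 0 := by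
    have := hρd.map_nhds_eq one_ne_zero
    simpa [hρ] using this
  have hfρ : ∀ᶠ z in nhds (0:ℂ), f z = φ 0 * ρ z ^ n ∧ z ∈ ball (0:ℂ) r := by
    have h1 : ∀ᶠ z in nhds (0:ℂ), φ z ≠ 0 := hφ.continuousAt.eventually_ne hφ0
    filter_upwards [hφe, h1, hball] with z h1 h2 h3
    refine ⟨?_, h3⟩
    rw [h1, hρ]
    simp only
    rw [mul_pow, ← Complex.exp_nat_mul, mul_div_cancel₀ _ (by exact_mod_cast hn0),
      Complex.exp_log (div_ne_zero h2 hφ0)]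
    field_simp
  obtain ⟨ω, hω⟩ : ∃ ω : ℂ, IsPrimitiveRoot ω n := ⟨_, Complex.isPrimitiveRoot_exp n hn0⟩
  have hω1 : ω ≠ 1 := by
    intro h
    rw [h] at hω
    exact hn1 (hω.unique IsPrimitiveRoot.one)
  have himg : ρ '' {z | f z = φ 0 * ρ z ^ n ∧ z ∈ ball (0:ℂ) r} ∈ nhds (0:ℂ) := by
    rw [← hmap]; exact image_mem_map hfρ
  have himg2 : ∀ᶠ w in nhds (0:ℂ), ω * w ∈ ρ '' {z | f z = φ 0 * ρ z ^ n ∧ z ∈ ball (0:ℂ) r} := by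
    have : Tendsto (fun w : ℂ => ω * w) (nhds 0) (nhds 0) := by
      have := (continuous_const_mul ω).tendsto 0
      simpa using this
    exact this himg
  have h2 := ((himg2.and himg).filter_mono (nhdsWithin_le_nhds (s := {(0:ℂ)}ᶜ))).and self_mem_nhdsWithin
  obtain ⟨w, ⟨⟨z1, hz1, e1⟩, ⟨z2, hz2, e2⟩⟩, hw⟩ := h2.exists
  have : f z1 = f z2 := by
    rw [hz1.1, hz2.1, e1, e2, mul_pow, hω.pow_eq_one, one_mul]
  have h3 := hfinj hz1.2 hz2.2 this
  rw [h3, e2] at e1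
  have hw' : w ≠ 0 := hw
  have : (ω - 1) * w = 0 := by linear_combination -e1
  rcases mul_eq_zero.1 this with h | h
  · exact hω1 (sub_eq_zero.1 h)
  · exact hw' h

def grAnn (a b : ℝ) : Set ℂ := {z | a < ‖z‖ ∧ ‖z‖ < b}

theorem grAnn_isOpen (a b : ℝ) : IsOpen (grAnn a b) :=
  (isOpen_lt continuous_const continuous_norm).inter (isOpen_lt continuous_norm continuous_const)

theorem grAnn_polar {E : Type*} [NormedAddCommGroup E] [NormedSpace ℝ E] (H : ℂ → E) {a b : ℝ}
    (ha : 0 ≤ a) :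
    ∫ z in grAnn a b, H z = ∫ p in Ioo a b ×ˢ Ioo (-Real.pi) Real.pi,
      (p.1:ℝ) • H (circleMap 0 p.1 p.2) := by
  rw [← integral_indicator (grAnn_isOpen a b).measurableSet, ← Complex.integral_comp_polarCoord_symm,
    ← integral_indicator (measurableSet_Ioo.prod measurableSet_Ioo),
    ← integral_indicator (by exact measurableSet_Ioi.prod measurableSet_Ioo)]
  congr 1
  ext p
  have hpt : Complex.polarCoord.symm p = circleMap 0 p.1 p.2 := by
    rw [Complex.polarCoord_symm_apply, circleMap, Complex.exp_mul_I]; simp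
  by_cases hp : p ∈ Ioi (0:ℝ) ×ˢ Ioo (-Real.pi) Real.pi
  · rw [indicator_of_mem (by exact hp), hpt]
    have hp1 : 0 < p.1 := hp.1
    by_cases h : circleMap 0 p.1 p.2 ∈ grAnn a b
    · rw [indicator_of_mem h, indicator_of_mem]
      simp [grAnn, abs_of_pos hp1] at h
      exact ⟨h, hp.2⟩
    · rw [indicator_of_notMem h, indicator_of_notMem, smul_zero]
      simp [grAnn, abs_of_pos hp1] at h
      rintro ⟨h1, -⟩
      exact absurd h1.2 (not_lt.2 (h h1.1))
  · rw [indicator_of_notMem (by exact hp), indicator_of_notMem]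
    rintro ⟨h1, h2⟩
    exact hp ⟨lt_of_le_of_lt ha h1.1, h2⟩

theorem grAnn_integral_inv {a b : ℝ} (ha : 0 < a) (hab : a ≤ b) :
    ∫ z in grAnn a b, 1 / ‖z‖ ^ 2 = 2 * Real.pi * Real.log (b / a) := by
  rw [grAnn_polar _ ha.le]
  have : ∫ p in Ioo a b ×ˢ Ioo (-Real.pi) Real.pi, (p.1:ℝ) • (1 / ‖circleMap 0 p.1 p.2‖ ^ 2)
      = ∫ p in Ioo a b ×ˢ Ioo (-Real.pi) Real.pi, (p.1⁻¹ * 1 : ℝ) := by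
    apply setIntegral_congr_fun (measurableSet_Ioo.prod measurableSet_Ioo)
    rintro p ⟨h1, -⟩
    have : 0 < p.1 := ha.trans h1.1
    simp
    field_simp
  rw [this, Measure.volume_eq_prod, setIntegral_prod_mul (fun x : ℝ => x⁻¹) (fun _ => (1:ℝ)),
    ← integral_Ioc_eq_integral_Ioo, ← intervalIntegral.integral_of_le hab,
    integral_inv_of_pos ha (ha.trans_le hab)]
  simp
  rw [max_eq_left (by positivity)]
  ring

theorem grAnn_cross {h : ℂ → ℂ} (hh : DifferentiableOn ℂ h (ball 0 1)) {a b : ℝ} (ha : 0 < a)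
    (hb : b < 1) :
    ∫ z in grAnn a b, h z / (starRingEnd ℂ) z = 0 := by
  rw [grAnn_polar _ ha.le]
  have e : ∫ p in Ioo a b ×ˢ Ioo (-Real.pi) Real.pi,
      (p.1:ℝ) • (h (circleMap 0 p.1 p.2) / (starRingEnd ℂ) (circleMap 0 p.1 p.2))
      = ∫ p in Ioo a b ×ˢ Ioo (-Real.pi) Real.pi,
        h (circleMap 0 p.1 p.2) * Complex.exp (p.2 * I) := by
    apply setIntegral_congr_fun (measurableSet_Ioo.prod measurableSet_Ioo)
    rintro p ⟨h1, -⟩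
    have h1 : 0 < p.1 := ha.trans h1.1
    have h1' : (p.1:ℂ) ≠ 0 := by exact_mod_cast h1.ne'
    simp only [circleMap, zero_add, map_mul, Complex.conj_ofReal, ← Complex.exp_conj, Complex.conj_I,
      Complex.real_smul]
    rw [mul_neg, Complex.exp_neg]
    field_simp
  rw [e, Measure.volume_eq_prod, setIntegral_prod]
  · apply setIntegral_eq_zero_of_forall_eq_zero
    intro r hr
    have h1 : 0 < r := ha.trans hr.1
    have h1' : (r:ℂ) ≠ 0 := by exact_mod_cast h1.ne'
    simp only
    rw [← integral_Ioc_eq_integral_Ioo, ← intervalIntegral.integral_of_le (by linarith [Real.pi_pos])]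
    have hd : DiffContOnCl ℂ h (ball 0 r) :=
      (hh.mono (by rw [closure_ball _ h1.ne']; exact closedBall_subset_ball (hr.2.trans hb))).diffContOnCl
    have hc := hd.circleIntegral_eq_zero h1.le
    rw [circleIntegral] at hc
    have hper : Function.Periodic (fun θ : ℝ => deriv (circleMap 0 r) θ • h (circleMap 0 r θ))
        (2 * Real.pi) := by
      intro θ
      simp only [deriv_circleMap]
      rw [periodic_circleMap 0 r θ]
    have h3 := hper.intervalIntegral_add_eq (-Real.pi) 0
    rw [zero_add, hc] at h3
    have h4 : (r * I) * ∫ θ in (-Real.pi)..Real.pi, h (circleMap 0 r θ) * Complex.exp (θ * I) = 0 := by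
      rw [← intervalIntegral.integral_const_mul]
      rw [show -Real.pi + 2 * Real.pi = Real.pi by ring] at h3
      refine Eq.trans ?_ h3
      congr 1
      ext θ
      simp [deriv_circleMap, circleMap]
      ring
    exact (mul_eq_zero.1 h4).resolve_left (mul_ne_zero h1' I_ne_zero)
  · have : ContinuousOn (fun p : ℝ × ℝ => h (circleMap 0 p.1 p.2) * Complex.exp (p.2 * I))
        (Icc a b ×ˢ Icc (-Real.pi) Real.pi) := by
      apply ContinuousOn.mul
      · apply hh.continuousOn.comp
        · apply Continuous.continuousOn
          unfold circleMap
          fun_prop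
        · rintro p ⟨h1, -⟩
          simp [abs_of_pos (ha.trans_le h1.1)]
          exact h1.2.trans_lt hb
      · fun_prop
    rw [← Measure.volume_eq_prod]
    exact (this.integrableOn_compact (isCompact_Icc.prod isCompact_Icc)).mono_set
      (prod_mono Ioo_subset_Icc_self Ioo_subset_Icc_self)

theorem gr_det (c : ℂ) : |((c • (1 : ℂ →L[ℝ] ℂ)) : ℂ →L[ℝ] ℂ).det| = ‖c‖ ^ 2 := by
  have h : ((c • (1 : ℂ →L[ℝ] ℂ)) : ℂ →L[ℝ] ℂ).det = Algebra.norm ℝ c := by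
    rw [Algebra.norm_apply, ContinuousLinearMap.det]
    congr 1
  rw [h, Algebra.norm_complex_apply, Complex.normSq_eq_norm_sq, abs_of_nonneg (by positivity)]

theorem gr_cov {G : ℂ → ℂ} {s : Set ℂ} (hs : IsOpen s) (hG : DifferentiableOn ℂ G s)
    (hinj : InjOn G s) (k : ℂ → ℝ) :
    ∫ w in G '' s, k w = ∫ z in s, ‖deriv G z‖ ^ 2 * k (G z) := by
  rw [integral_image_eq_integral_abs_det_fderiv_smul volume hs.measurableSet
    (fun x hx => ((hG.differentiableAt
      (hs.mem_nhds hx)).hasDerivAt.complexToReal_fderiv).hasFDerivWithinAt) hinj]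
  simp only [gr_det, smul_eq_mul]

theorem grAnn_subset {a b c : ℝ} (hb : b ≤ c) : grAnn a b ⊆ ball 0 c := by
  intro z hz
  simpa using hz.2.trans_le hb

theorem grAnn_ne {a b : ℝ} (ha : 0 ≤ a) {z : ℂ} (hz : z ∈ grAnn a b) : z ≠ 0 := by
  rintro rfl
  have := hz.1
  simp at this
  linarith

theorem grAnn_integrableOn {E : Type*} [NormedAddCommGroup E] {k : ℂ → E} {a b : ℝ} 
    (hk : ContinuousOn k {z | a ≤ ‖z‖ ∧ ‖z‖ ≤ b}) : IntegrableOn k (grAnn a b) := by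
  have hc : IsCompact {z : ℂ | a ≤ ‖z‖ ∧ ‖z‖ ≤ b} := by
    apply (isCompact_closedBall (0:ℂ) b).of_isClosed_subset
    · exact (isClosed_le continuous_const continuous_norm).inter
        (isClosed_le continuous_norm continuous_const)
    · intro z hz
      simpa using hz.2
  exact (hk.integrableOn_compact hc).mono_set (fun z hz => ⟨hz.1.le, hz.2.le⟩)

theorem gr_energy {h : ℂ → ℂ} (hh : DifferentiableOn ℂ h (ball 0 1)) {a b : ℝ} (ha : 0 < a)
    (hab : a ≤ b) (hb : b < 1) :
    ∫ z in grAnn a b, ‖1 / z + h z‖ ^ 2 =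
      2 * Real.pi * Real.log (b / a) + ∫ z in grAnn a b, ‖h z‖ ^ 2 := by
  have hhc : ContinuousOn h {z | a ≤ ‖z‖ ∧ ‖z‖ ≤ b} := hh.continuousOn.mono (by
    intro z hz
    simpa using hz.2.trans_lt hb)
  have hne : ∀ z ∈ {z : ℂ | a ≤ ‖z‖ ∧ ‖z‖ ≤ b}, z ≠ 0 := by
    rintro z hz rfl
    have := hz.1
    simp at this
    linarith
  have i1 : IntegrableOn (fun z : ℂ => 1 / ‖z‖ ^ 2) (grAnn a b) := by
    apply grAnn_integrableOn
    apply ContinuousOn.div continuousOn_const (by fun_prop)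
    intro z hz
    simpa using hne z hz
  have i2 : IntegrableOn (fun z : ℂ => ‖h z‖ ^ 2) (grAnn a b) :=
    grAnn_integrableOn (hhc.norm.pow 2)
  have i3 : IntegrableOn (fun z : ℂ => h z / (starRingEnd ℂ) z) (grAnn a b) := by
    apply grAnn_integrableOn
    apply ContinuousOn.div hhc (by fun_prop)
    intro z hz
    simpa using hne z hz
  have e : ∫ z in grAnn a b, ‖1 / z + h z‖ ^ 2 = ∫ z in grAnn a b,
      (1 / ‖z‖ ^ 2 + ‖h z‖ ^ 2 + 2 * RCLike.re (h z / (starRingEnd ℂ) z)) := by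
    apply setIntegral_congr_fun (grAnn_isOpen a b).measurableSet
    intro z hz
    have hz0 := grAnn_ne ha.le hz
    simp only
    rw [← Complex.normSq_eq_norm_sq, Complex.normSq_add, Complex.normSq_eq_norm_sq,
      Complex.normSq_eq_norm_sq]
    have : (1 / z * (starRingEnd ℂ) (h z)).re = (h z / (starRingEnd ℂ) z).re := by
      rw [← Complex.conj_re (h z / (starRingEnd ℂ) z)]
      congr 1
      simp
      field_simp
    rw [this]
    simp
  have i12 : IntegrableOn (fun z : ℂ => 1 / ‖z‖ ^ 2 + ‖h z‖ ^ 2) (grAnn a b) := i1.add i2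
  rw [e, integral_add i12 (i3.re.const_mul 2), integral_add i1 i2,
    integral_const_mul, integral_re i3, grAnn_cross hh ha hb, grAnn_integral_inv ha hab]
  simp

theorem gr_structure {f : ℂ → ℂ} (hf : DifferentiableOn ℂ f (ball (0:ℂ) 1))
    (hfinj : InjOn f (ball (0:ℂ) 1)) (hf0 : f 0 = 0) :
    ∃ h : ℂ → ℂ, DifferentiableOn ℂ h (ball 0 1) ∧
      ∀ z ∈ ball (0:ℂ) 1, z ≠ 0 → deriv f z / f z = 1 / z + h z := by
  have hball : ball (0:ℂ) 1 ∈ nhds (0:ℂ) := ball_mem_nhds _ one_pos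
  set φ := dslope f 0 with hφ
  have hφd : DifferentiableOn ℂ φ (ball 0 1) := (differentiableOn_dslope hball).2 hf
  have hfne : ∀ z ∈ ball (0:ℂ) 1, z ≠ 0 → f z ≠ 0 := fun z hz h0 h =>
    h0 (hfinj hz (mem_ball_self one_pos) (by rw [h, hf0]))
  have hφe : ∀ z, f z = z * φ z := by
    intro z
    have := sub_smul_dslope f 0 z
    simp [hf0] at this
    exact this.symm
  have hφne : ∀ z ∈ ball (0:ℂ) 1, φ z ≠ 0 := by
    intro z hz
    by_cases h0 : z = 0
    · rw [h0, hφ, dslope_same]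
      exact gr_deriv_ne_zero one_pos hf hfinj hf0
    · intro h
      exact hfne z hz h0 (by rw [hφe, h, mul_zero])
  refine ⟨fun z => deriv φ z / φ z, (hφd.deriv isOpen_ball).div hφd hφne, ?_⟩
  intro z hz h0
  have hd : HasDerivAt f (1 * φ z + z * deriv φ z) z := by
    have h1 := (hasDerivAt_id' z).fun_mul
      (hφd.differentiableAt (isOpen_ball.mem_nhds hz)).hasDerivAt
    exact h1.congr_of_eventuallyEq (Eventually.of_forall hφe)
  rw [hd.deriv, hφe]
  have := hφne z hz
  field_simp
  
theorem gr_cover {f : ℂ → ℂ} (hf : DifferentiableOn ℂ f (ball (0:ℂ) 1))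
    (hf0 : f 0 = 0) {c : ℝ} (hc : 0 < c) (hcf : c < ‖deriv f 0‖) :
    ∀ᶠ δ in nhdsWithin (0:ℝ) (Ioi 0), closedBall (0:ℂ) (δ * c) ⊆ f '' closedBall 0 δ := by
  have hball : ball (0:ℂ) 1 ∈ nhds (0:ℂ) := ball_mem_nhds _ one_pos
  have hfa : AnalyticAt ℂ f 0 := hf.analyticAt hball
  have hd : HasStrictDerivAt f (deriv f 0) 0 := hfa.hasStrictDerivAt
  have hmap : map f (nhds 0) = nhds 0 := by
    have := hd.map_nhds_eq (by intro h; rw [h, norm_zero] at hcf; linarith)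
    rwa [hf0] at this
  have hloc : ∀ᶠ z in nhds (0:ℂ), c * ‖z‖ ≤ ‖f z‖ := by
    have h1 := hd.hasDerivAt.isLittleO
    have h2 := h1.def (sub_pos.2 hcf)
    filter_upwards [h2] with z hz
    simp only [hf0, sub_zero, smul_eq_mul] at hz
    have h3 : ‖z * deriv f 0‖ ≤ ‖f z‖ + ‖f z - z * deriv f 0‖ := by
      have := norm_sub_le (f z) (f z - z * deriv f 0)
      simpa using this
    rw [norm_mul] at h3
    nlinarith
  have himg : f '' {z | c * ‖z‖ ≤ ‖f z‖} ∈ nhds (0:ℂ) := by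
    rw [← hmap]; exact image_mem_map hloc
  obtain ⟨ε, hε, hsub⟩ := Metric.mem_nhds_iff.1 himg
  have : Ioo (0:ℝ) (ε / c) ∈ nhdsWithin (0:ℝ) (Ioi 0) := Ioo_mem_nhdsGT (by positivity)
  filter_upwards [this] with δ hδ
  intro w hw
  have hw' : ‖w‖ ≤ δ * c := by simpa using hw
  have : w ∈ ball (0:ℂ) ε := by
    have h := hδ.2
    rw [lt_div_iff₀ hc] at h
    simpa using hw'.trans_lt h
  obtain ⟨z, hz, rfl⟩ := hsub this
  refine ⟨z, ?_, rfl⟩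
  have hz' : c * ‖z‖ ≤ ‖f z‖ := hz
  have : ‖z‖ ≤ δ := by
    by_contra h
    push Not at h
    nlinarith
  simpa using this

theorem gr_area {f F h k : ℂ → ℂ} (hf : DifferentiableOn ℂ f (ball (0:ℂ) 1))
    (hfinj : InjOn f (ball (0:ℂ) 1)) (hf0 : f 0 = 0)
    (hF : DifferentiableOn ℂ F (ball (0:ℂ) 1))
    (hFinj : InjOn F (ball (0:ℂ) 1)) (hF0 : F 0 = 0)
    (hdis : ∀ z ∈ ball (0:ℂ) 1, ∀ w ∈ ball (0:ℂ) 1, f z * F w ≠ 1)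
    (hh : DifferentiableOn ℂ h (ball 0 1))
    (hhe : ∀ z ∈ ball (0:ℂ) 1, z ≠ 0 → deriv f z / f z = 1 / z + h z)
    (hk : DifferentiableOn ℂ k (ball 0 1))
    (hke : ∀ z ∈ ball (0:ℂ) 1, z ≠ 0 → deriv F z / F z = 1 / z + k z)
    {δ r c d : ℝ} (hδ : 0 < δ) (hδr : δ < r) (hr : r < 1) (hc : 0 < c) (hd : 0 < d)
    (hcf : closedBall (0:ℂ) (δ * c) ⊆ f '' closedBall 0 δ)
    (hdF : closedBall (0:ℂ) (δ * d) ⊆ F '' closedBall 0 δ) :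
    (∫ z in grAnn δ r, ‖h z‖ ^ 2) + (∫ z in grAnn δ r, ‖k z‖ ^ 2) ≤
      - (2 * Real.pi * Real.log (r ^ 2 * (c * d))) := by
  have hAb : grAnn δ r ⊆ ball 0 1 := grAnn_subset hr.le
  have hδb : closedBall (0:ℂ) δ ⊆ ball 0 1 := closedBall_subset_ball (hδr.trans hr)
  have hfne : ∀ z ∈ ball (0:ℂ) 1, z ≠ 0 → f z ≠ 0 := fun z hz h0 h =>
    h0 (hfinj hz (mem_ball_self one_pos) (by rw [h, hf0]))
  have hFne : ∀ z ∈ ball (0:ℂ) 1, z ≠ 0 → F z ≠ 0 := fun z hz h0 h =>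
    h0 (hFinj hz (mem_ball_self one_pos) (by rw [h, hF0]))
  -- general bounds
  have low : ∀ {u : ℂ → ℂ} {e : ℝ}, InjOn u (ball (0:ℂ) 1) →
      closedBall (0:ℂ) (δ * e) ⊆ u '' closedBall 0 δ → ∀ z ∈ grAnn δ r, δ * e < ‖u z‖ := by
    intro u e hu hsub z hz
    by_contra hcon
    push Not at hcon
    obtain ⟨z', hz', he⟩ := hsub (show u z ∈ closedBall (0:ℂ) (δ * e) by simpa using hcon)
    have := hu (hδb hz') (hAb hz) he
    subst this
    have h1 := hz.1
    have h2 : ‖z'‖ ≤ δ := by simpa using hz'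
    linarith
  have upf : ∀ z ∈ grAnn δ r, ‖f z‖ < 1 / (δ * d) := by
    intro z hz
    by_contra hcon
    push Not at hcon
    have hne := hfne z (hAb hz) (grAnn_ne hδ.le hz)
    obtain ⟨w, hw, he⟩ := hdF (show (f z)⁻¹ ∈ closedBall (0:ℂ) (δ * d) by
      simp only [mem_closedBall, dist_zero_right, norm_inv]
      rw [inv_le_comm₀ (norm_pos_iff.2 hne) (by positivity)]
      simpa using hcon)
    exact hdis z (hAb hz) w (hδb hw) (by rw [he, mul_inv_cancel₀ hne])
  have upF : ∀ z ∈ grAnn δ r, ‖F z‖ < 1 / (δ * c) := by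
    intro z hz
    by_contra hcon
    push Not at hcon
    have hne := hFne z (hAb hz) (grAnn_ne hδ.le hz)
    obtain ⟨w, hw, he⟩ := hcf (show (F z)⁻¹ ∈ closedBall (0:ℂ) (δ * c) by
      simp only [mem_closedBall, dist_zero_right, norm_inv]
      rw [inv_le_comm₀ (norm_pos_iff.2 hne) (by positivity)]
      simpa using hcon)
    exact hdis w (hδb hw) z (hAb hz) (by rw [he, inv_mul_cancel₀ hne])
  set A := grAnn δ r with hA
  have hAo : IsOpen A := grAnn_isOpen δ r
  set G : ℂ → ℂ := fun z => (F z)⁻¹ with hG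
  have hfA := hf.mono hAb
  have hFA := hF.mono hAb
  have hFA0 : ∀ z ∈ A, F z ≠ 0 := fun z hz => hFne z (hAb hz) (grAnn_ne hδ.le hz)
  have hGA : DifferentiableOn ℂ G A := hFA.inv hFA0
  have hGinj : InjOn G A := fun x hx y hy hxy => hFinj (hAb hx) (hAb hy) (inv_injective hxy)
  have hGd : ∀ z ∈ A, ‖deriv G z‖ ^ 2 * (1 / ‖G z‖ ^ 2) = ‖1 / z + k z‖ ^ 2 := by
    intro z hz
    have h1 := (hFA.differentiableAt (hAo.mem_nhds hz)).hasDerivAt.inv (hFA0 z hz)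
    have h2 : deriv G z = -deriv F z / F z ^ 2 := h1.deriv
    rw [← hke z (hAb hz) (grAnn_ne hδ.le hz), h2, hG]
    have := norm_pos_iff.2 (hFA0 z hz)
    simp only [norm_div, norm_neg, norm_pow, norm_inv]
    field_simp
  have hfd : ∀ z ∈ A, ‖deriv f z‖ ^ 2 * (1 / ‖f z‖ ^ 2) = ‖1 / z + h z‖ ^ 2 := by
    intro z hz
    rw [← hhe z (hAb hz) (grAnn_ne hδ.le hz), norm_div, div_pow]
    ring
  have ef := gr_cov hAo hfA (hfinj.mono hAb) (fun w => 1 / ‖w‖ ^ 2)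
  have eG := gr_cov hAo hGA hGinj (fun w => 1 / ‖w‖ ^ 2)
  rw [setIntegral_congr_fun hAo.measurableSet hfd, gr_energy hh hδ hδr.le hr] at ef
  rw [setIntegral_congr_fun hAo.measurableSet hGd, gr_energy hk hδ hδr.le hr] at eG
  set B := grAnn (δ * c) (1 / (δ * d)) with hB
  have hfB : f '' A ⊆ B := by
    rintro _ ⟨z, hz, rfl⟩
    exact ⟨low hfinj hcf z hz, upf z hz⟩
  have hGB : G '' A ⊆ B := by
    rintro _ ⟨z, hz, rfl⟩
    have h0 := norm_pos_iff.2 (hFA0 z hz)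
    refine ⟨?_, ?_⟩
    · rw [hG]
      simp only [norm_inv]
      rw [lt_inv_comm₀ (by positivity) h0]
      simpa using upF z hz
    · rw [hG]
      simp only [norm_inv, one_div]
      rw [inv_lt_inv₀ h0 (by positivity)]
      exact low hFinj hdF z hz
  have hBi : IntegrableOn (fun w : ℂ => 1 / ‖w‖ ^ 2) B := by
    apply grAnn_integrableOn
    apply ContinuousOn.div continuousOn_const (by fun_prop)
    rintro z hz h0
    have h1 : z = 0 := by simpa using h0
    have h2 := hz.1
    rw [h1, norm_zero] at h2
    have : 0 < δ * c := by positivity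
    linarith
  have hdisj : Disjoint (f '' A) (G '' A) := by
    rw [Set.disjoint_left]
    rintro _ ⟨z, hz, rfl⟩ ⟨w, hw, he⟩
    apply hdis z (hAb hz) w (hAb hw)
    rw [← he, hG]
    exact inv_mul_cancel₀ (hFA0 w hw)
  have hGm : MeasurableSet (G '' A) :=
    measurable_image_of_fderivWithin hAo.measurableSet
      (fun x hx => ((hGA.differentiableAt
        (hAo.mem_nhds hx)).hasDerivAt.complexToReal_fderiv).hasFDerivWithinAt) hGinj
  have hle : ∫ w in f '' A ∪ G '' A, 1 / ‖w‖ ^ 2 ≤ ∫ w in B, 1 / ‖w‖ ^ 2 :=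
    setIntegral_mono_set hBi (ae_of_all _ fun w => by positivity)
      (LE.le.eventuallyLE (union_subset hfB hGB))
  rw [setIntegral_union hdisj hGm (hBi.mono_set hfB) (hBi.mono_set hGB), ef, eG] at hle
  have hBne : δ * c ≤ 1 / (δ * d) := by
    have hz : (((δ + r) / 2 : ℝ) : ℂ) ∈ A := by
      have : |(δ + r) / 2| = (δ + r) / 2 := abs_of_pos (by linarith)
      constructor
      · rw [Complex.norm_real, Real.norm_eq_abs, this]; linarith
      · rw [Complex.norm_real, Real.norm_eq_abs, this]; linarith
    have := hfB ⟨_, hz, rfl⟩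
    exact (this.1.trans this.2).le
  rw [grAnn_integral_inv (by positivity) hBne] at hle
  have hr0 : 0 < r := hδ.trans hδr
  have l1 : Real.log (r / δ) = Real.log r - Real.log δ := Real.log_div hr0.ne' hδ.ne'
  have l2 : Real.log (1 / (δ * d) / (δ * c)) =
      - (2 * Real.log δ + Real.log c + Real.log d) := by
    rw [Real.log_div (by positivity) (by positivity), Real.log_div (by positivity) (by positivity),
      Real.log_mul hδ.ne' hd.ne', Real.log_mul hδ.ne' hc.ne', Real.log_one]
    ring
  have l3 : Real.log (r ^ 2 * (c * d)) = 2 * Real.log r + Real.log c + Real.log d := by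
    rw [Real.log_mul (by positivity) (by positivity), Real.log_mul hc.ne' hd.ne', Real.log_pow]
    push_cast
    ring
  rw [l1, l2] at hle
  rw [l3]
  linarith

theorem gr_sym {f F : ℂ → ℂ} (hf : DifferentiableOn ℂ f (ball (0:ℂ) 1))
    (hfinj : InjOn f (ball (0:ℂ) 1)) (hf0 : f 0 = 0)
    (hF : DifferentiableOn ℂ F (ball (0:ℂ) 1))
    (hFinj : InjOn F (ball (0:ℂ) 1)) (hF0 : F 0 = 0)
    (hdis : ∀ z ∈ ball (0:ℂ) 1, ∀ w ∈ ball (0:ℂ) 1, f z * F w ≠ 1) :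
    (∫ z in ball (0:ℂ) 1, ‖deriv f z / f z - 1 / z‖ ^ 2) +
      (∫ z in ball (0:ℂ) 1, ‖deriv F z / F z - 1 / z‖ ^ 2) ≤
      - (2 * Real.pi * Real.log (‖deriv f 0‖ * ‖deriv F 0‖)) := by
  obtain ⟨h, hh, hhe⟩ := gr_structure hf hfinj hf0
  obtain ⟨k, hk, hke⟩ := gr_structure hF hFinj hF0
  have hne0 : ∀ᵐ z : ℂ, z ≠ 0 := by
    rw [ae_iff]; simp
  have e1 : ∫ z in ball (0:ℂ) 1, ‖deriv f z / f z - 1 / z‖ ^ 2 =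
      ∫ z in ball (0:ℂ) 1, ‖h z‖ ^ 2 := by
    apply setIntegral_congr_ae isOpen_ball.measurableSet
    filter_upwards [hne0] with z hz hb
    rw [hhe z hb hz, add_sub_cancel_left]
  have e2 : ∫ z in ball (0:ℂ) 1, ‖deriv F z / F z - 1 / z‖ ^ 2 =
      ∫ z in ball (0:ℂ) 1, ‖k z‖ ^ 2 := by
    apply setIntegral_congr_ae isOpen_ball.measurableSet
    filter_upwards [hne0] with z hz hb
    rw [hke z hb hz, add_sub_cancel_left]
  rw [e1, e2]
  have ha : 0 < ‖deriv f 0‖ := norm_pos_iff.2 (gr_deriv_ne_zero one_pos hf hfinj hf0)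
  have hb : 0 < ‖deriv F 0‖ := norm_pos_iff.2 (gr_deriv_ne_zero one_pos hF hFinj hF0)
  set a := ‖deriv f 0‖
  set b := ‖deriv F 0‖
  -- exhaustion, indexed by δ → 0+
  set l := nhdsWithin (0:ℝ) (Ioi 0) with hl
  set A : ℝ → Set ℂ := fun δ => grAnn δ (1 - δ) with hA
  have hl0 : Tendsto (fun δ : ℝ => δ) l (nhds 0) := nhdsWithin_le_nhds
  have hlpos : ∀ᶠ δ in l, 0 < δ := self_mem_nhdsWithin
  have hlt : ∀ {t : ℝ}, 0 < t → ∀ᶠ δ in l, δ < t := fun ht => hl0.eventually (gt_mem_nhds ht)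
  have hcov : AECover (volume.restrict (ball (0:ℂ) 1)) l A := by
    apply aecover_restrict_of_ae_imp isOpen_ball.measurableSet
    · filter_upwards [hne0] with z hz hb
      have h1 : ‖z‖ < 1 := by simpa using hb
      filter_upwards [hlt (norm_pos_iff.2 hz), hlt (sub_pos.2 h1)] with δ h2 h3
      exact ⟨h2, by linarith⟩
    · intro δ
      exact (grAnn_isOpen _ _).measurableSet
  have hres : ∀ u : ℂ → ℝ, ∀ᶠ δ in l, ∫ z in A δ, u z ∂(volume.restrict (ball (0:ℂ) 1)) =
      ∫ z in A δ, u z := by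
    intro u
    filter_upwards [hlpos] with δ hδ
    rw [Measure.restrict_restrict (grAnn_isOpen _ _).measurableSet,
      inter_eq_left.2 (grAnn_subset (by linarith))]
  -- main inequality
  have main : ∀ t ∈ Ioo (0:ℝ) 1, ∀ᶠ δ in l,
      (∫ z in A δ, ‖h z‖ ^ 2 ∂(volume.restrict (ball (0:ℂ) 1))) +
      (∫ z in A δ, ‖k z‖ ^ 2 ∂(volume.restrict (ball (0:ℂ) 1))) ≤
      - (2 * Real.pi * Real.log ((1 - δ) ^ 2 * ((t * a) * (t * b)))) := by
    intro t ht
    have hta : 0 < t * a := mul_pos ht.1 ha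
    have htb : 0 < t * b := mul_pos ht.1 hb
    filter_upwards [hlpos, hlt (show (0:ℝ) < 1 / 2 by norm_num), hres (fun z => ‖h z‖ ^ 2),
      hres (fun z => ‖k z‖ ^ 2),
      gr_cover hf hf0 hta (show t * a < a by nlinarith [ht.2]),
      gr_cover hF hF0 htb (show t * b < b by nlinarith [ht.2])] with δ h1 h2 h3 h4 h5 h6
    rw [h3, h4]
    exact gr_area hf hfinj hf0 hF hFinj hF0 hdis hh hhe hk hke h1 (by linarith) (by linarith)
      hta htb h5 h6
  -- limit of the RHS
  have hlim : ∀ t ∈ Ioo (0:ℝ) 1, Tendsto (fun δ : ℝ =>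
      - (2 * Real.pi * Real.log ((1 - δ) ^ 2 * ((t * a) * (t * b))))) l
      (nhds (- (2 * Real.pi * Real.log ((t * a) * (t * b))))) := by
    intro t ht
    have hta : 0 < t * a := mul_pos ht.1 ha
    have htb : 0 < t * b := mul_pos ht.1 hb
    have h1 : Tendsto (fun δ : ℝ => (1 - δ) ^ 2 * ((t * a) * (t * b))) l
        (nhds ((1 - 0) ^ 2 * ((t * a) * (t * b)))) :=
      ((hl0.const_sub 1).pow 2).mul_const _
    simp only [sub_zero, one_pow, one_mul] at h1
    exact ((h1.log (by positivity)).const_mul _).neg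
  have hint : ∀ u : ℂ → ℂ, DifferentiableOn ℂ u (ball 0 1) →
      (∃ C, ∀ᶠ δ in l, (∫ z in A δ, ‖u z‖ ^ 2 ∂(volume.restrict (ball (0:ℂ) 1))) ≤ C) →
      Integrable (fun z => ‖u z‖ ^ 2) (volume.restrict (ball (0:ℂ) 1)) := by
    intro u hu ⟨C, hC⟩
    -- use the positive subfamily
    have hcov' : AECover (volume.restrict (ball (0:ℂ) 1)) l (fun δ => A δ ∩ {_z | 0 < δ}) := by
      refine ⟨?_, ?_⟩
      · filter_upwards [hcov.ae_eventually_mem] with z hz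
        filter_upwards [hz, hlpos] with δ h1 h2
        exact ⟨h1, h2⟩
      · intro δ
        exact (hcov.measurableSet δ).inter (MeasurableSet.const _)
    refine hcov'.integrable_of_integral_bounded_of_nonneg_ae C ?_ ?_ ?_
    · intro δ
      by_cases hδ : 0 < δ
      · simp only [hδ, ofPred_true, inter_univ]
        apply IntegrableOn.restrict
        apply grAnn_integrableOn
        refine (hu.continuousOn.mono ?_).norm.pow 2
        intro z hz
        have := hz.2
        simp only [mem_ball, dist_zero_right]
        linarith
      · simp [hδ]
    · exact ae_of_all _ fun z => by positivity
    · filter_upwards [hC, hlpos] with δ h1 h2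
      simpa [h2] using h1
  have hbdd := (hlim (1/2) (by norm_num)).eventually (gt_mem_nhds (lt_add_one _))
  have hnn : ∀ (u : ℂ → ℂ) δ, 0 ≤ ∫ z in A δ, ‖u z‖ ^ 2 ∂(volume.restrict (ball (0:ℂ) 1)) :=
    fun u δ => integral_nonneg fun z => by positivity
  have ih := hint h hh ⟨_, by
    filter_upwards [main (1/2) (by norm_num), hbdd] with δ h1 h2
    exact (le_add_of_nonneg_right (hnn k δ)).trans (h1.trans h2.le)⟩
  have ik := hint k hk ⟨_, by
    filter_upwards [main (1/2) (by norm_num), hbdd] with δ h1 h2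
    exact (le_add_of_nonneg_left (hnn h δ)).trans (h1.trans h2.le)⟩
  have th := hcov.integral_tendsto_of_countably_generated ih
  have tk := hcov.integral_tendsto_of_countably_generated ik
  have hfin : ∀ t ∈ Ioo (0:ℝ) 1, (∫ z in ball (0:ℂ) 1, ‖h z‖ ^ 2) +
      (∫ z in ball (0:ℂ) 1, ‖k z‖ ^ 2) ≤ - (2 * Real.pi * Real.log ((t * a) * (t * b))) :=
    fun t ht => le_of_tendsto_of_tendsto (th.add tk) (hlim t ht) (main t ht)
  have hl1 : Tendsto (fun t : ℝ => - (2 * Real.pi * Real.log ((t * a) * (t * b))))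
      (nhdsWithin 1 (Iio 1)) (nhds (- (2 * Real.pi * Real.log ((1 * a) * (1 * b))))) := by
    have h0 : Tendsto (fun t : ℝ => t) (nhdsWithin (1:ℝ) (Iio 1)) (nhds 1) := nhdsWithin_le_nhds
    have h1 := (h0.mul_const a).mul (h0.mul_const b)
    exact ((h1.log (by positivity)).const_mul _).neg
  rw [one_mul, one_mul] at hl1
  refine ge_of_tendsto hl1 ?_
  filter_upwards [Ioo_mem_nhdsLT (show (0:ℝ) < 1 by norm_num)] with t ht
  exact hfin t ht

theorem grunsky_inequality
    (f g : ℂ → ℂ) (gp : ℂ)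
    (hf : DifferentiableOn ℂ f (ball (0:ℂ) 1))
    (hfinj : InjOn f (ball (0:ℂ) 1))
    (hf0 : f 0 = 0)
    (hg : DifferentiableOn ℂ g extDisk)
    (hginj : InjOn g extDisk)
    (hginf : Tendsto g (Bornology.cobounded ℂ) (Bornology.cobounded ℂ))
    (hgp : Tendsto (deriv g) (Bornology.cobounded ℂ) (nhds gp))
    (hdisj : Disjoint (f '' ball (0:ℂ) 1) (g '' extDisk)) :
    (∫ z in ball (0:ℂ) 1, ‖deriv f z / f z - 1 / z‖ ^ 2) +
      (∫ z in extDisk, ‖deriv g z / g z - 1 / z‖ ^ 2) ≤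
      2 * Real.pi * Real.log ‖gp / deriv f 0‖ ∧ ‖deriv f 0‖ ≤ ‖gp‖ := by
  have hext : IsOpen extDisk := isOpen_lt continuous_const continuous_norm
  have hgf : ∀ z ∈ ball (0:ℂ) 1, ∀ w ∈ extDisk, g w ≠ f z := fun z hz w hw h =>
    Set.disjoint_left.1 hdisj ⟨z, hz, rfl⟩ ⟨w, hw, h⟩
  have hg0 : ∀ w ∈ extDisk, g w ≠ 0 := fun w hw => by
    have := hgf 0 (mem_ball_self one_pos) w hw
    rwa [hf0] at this
  have hinv : ∀ z ∈ ball (0:ℂ) 1, z ≠ 0 → z⁻¹ ∈ extDisk := by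
    intro z hz h0
    have h1 : ‖z‖ < 1 := by simpa using hz
    change 1 < ‖z⁻¹‖
    rw [norm_inv]
    exact (one_lt_inv₀ (norm_pos_iff.2 h0)).2 h1
  set P : Set ℂ := ball (0:ℂ) 1 \ {0} with hP
  have hPo : IsOpen P := isOpen_ball.sdiff isClosed_singleton
  set F : ℂ → ℂ := Function.update (fun z => (g z⁻¹)⁻¹) 0 0 with hFdef
  have hF0 : F 0 = 0 := by simp [hFdef]
  have hFe : ∀ z, z ≠ 0 → F z = (g z⁻¹)⁻¹ := fun z hz => by simp [hFdef, hz]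
  have hFd : ∀ z ∈ P, HasDerivAt F (deriv g z⁻¹ / (z ^ 2 * g z⁻¹ ^ 2)) z := by
    rintro z ⟨hz, h0⟩
    have h0 : z ≠ 0 := h0
    have hzi := hinv z hz h0
    have h1 : HasDerivAt (fun z : ℂ => g z⁻¹) (deriv g z⁻¹ * (-(z ^ 2)⁻¹)) z :=
      (hg.differentiableAt (hext.mem_nhds hzi)).hasDerivAt.comp z (hasDerivAt_inv h0)
    have h2 := h1.fun_inv (hg0 _ hzi)
    have h3 : F =ᶠ[nhds z] fun z => (g z⁻¹)⁻¹ :=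
      (isOpen_ne.eventually_mem h0).mono fun w hw => hFe w hw
    have h4 := h2.congr_of_eventuallyEq h3
    have h5 : deriv g z⁻¹ / (z ^ 2 * g z⁻¹ ^ 2) =
        -(deriv g z⁻¹ * (-(z ^ 2)⁻¹)) / g z⁻¹ ^ 2 := by ring
    rw [h5]
    exact h4
  have hFc : ContinuousAt F 0 := by
    rw [hFdef, continuousAt_update_same]
    exact tendsto_inv₀_cobounded.comp (hginf.comp tendsto_inv₀_nhdsNE_zero)
  have hball : ball (0:ℂ) 1 ∈ nhds (0:ℂ) := ball_mem_nhds _ one_pos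
  have hF : DifferentiableOn ℂ F (ball 0 1) :=
    (Complex.differentiableOn_compl_singleton_and_continuousAt_iff hball).1
      ⟨fun z hz => (hFd z hz).differentiableAt.differentiableWithinAt, hFc⟩
  have hFne : ∀ z ∈ ball (0:ℂ) 1, z ≠ 0 → F z ≠ 0 := fun z hz h0 => by
    rw [hFe z h0]; exact inv_ne_zero (hg0 _ (hinv z hz h0))
  have hFinj : InjOn F (ball 0 1) := by
    intro x hx y hy hxy
    by_cases hx0 : x = 0
    · by_contra hne
      subst hx0
      rw [hF0] at hxy
      exact hFne y hy (Ne.symm hne) hxy.symm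
    · by_cases hy0 : y = 0
      · subst hy0
        rw [hF0] at hxy
        exact absurd hxy (hFne x hx hx0)
      · rw [hFe x hx0, hFe y hy0] at hxy
        exact inv_injective (hginj (hinv x hx hx0) (hinv y hy hy0) (inv_injective hxy))
  have hdis : ∀ z ∈ ball (0:ℂ) 1, ∀ w ∈ ball (0:ℂ) 1, f z * F w ≠ 1 := by
    intro z hz w hw h
    by_cases h0 : w = 0
    · rw [h0, hF0] at h; simp at h
    · rw [hFe w h0] at h
      have h1 := hg0 _ (hinv w hw h0)
      apply hgf z hz _ (hinv w hw h0)
      exact ((mul_inv_eq_one₀ h1).1 h).symm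
  have key := gr_sym hf hfinj hf0 hF hFinj hF0 hdis
  have hb := gr_deriv_ne_zero one_pos hF hFinj hF0
  have ha := gr_deriv_ne_zero one_pos hf hfinj hf0
  -- the derivative at infinity
  have hgpF : gp * deriv F 0 = 1 := by
    have t1 : Tendsto (deriv F) (nhdsWithin 0 {0}ᶜ) (nhds (deriv F 0)) :=
      ((hF.deriv isOpen_ball).differentiableAt hball).continuousAt.tendsto.mono_left
        nhdsWithin_le_nhds
    have t2 : Tendsto (fun z => F z / z) (nhdsWithin 0 {0}ᶜ) (nhds (deriv F 0)) := by
      have := (hF.differentiableAt hball).hasDerivAt.tendsto_slope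
      refine this.congr fun z => ?_
      simp [slope_def_field, hF0]
    have t3 : Tendsto (fun z : ℂ => deriv g z⁻¹) (nhdsWithin 0 {0}ᶜ) (nhds gp) :=
      hgp.comp tendsto_inv₀_nhdsNE_zero
    have t4 := t3.mul (t2.pow 2)
    have t5 : deriv F =ᶠ[nhdsWithin 0 {0}ᶜ] fun z => deriv g z⁻¹ * (F z / z) ^ 2 := by
      filter_upwards [self_mem_nhdsWithin, nhdsWithin_le_nhds hball] with z h0 hz
      rw [(hFd z ⟨hz, h0⟩).deriv, hFe z h0]
      have := hg0 _ (hinv z hz h0)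
      have h0 : z ≠ 0 := h0
      field_simp
    have := tendsto_nhds_unique t1 (t4.congr' t5.symm)
    have h2 : (gp * deriv F 0 - 1) * deriv F 0 = 0 := by linear_combination -this
    exact sub_eq_zero.1 ((mul_eq_zero.1 h2).resolve_right hb)
  -- the integral
  have himg : (fun z : ℂ => z⁻¹) '' P = extDisk := by
    apply Set.Subset.antisymm
    · rintro _ ⟨z, ⟨hz, h0⟩, rfl⟩
      exact hinv z hz h0
    · intro w hw
      have h1 : 1 < ‖w‖ := hw
      have h0 : w ≠ 0 := by
        rintro rfl
        simp at h1
        linarith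
      refine ⟨w⁻¹, ⟨?_, inv_ne_zero h0⟩, inv_inv w⟩
      simp only [mem_ball, dist_zero_right, norm_inv]
      exact inv_lt_one_of_one_lt₀ h1
  have hint : ∫ z in extDisk, ‖deriv g z / g z - 1 / z‖ ^ 2 =
      ∫ z in ball (0:ℂ) 1, ‖deriv F z / F z - 1 / z‖ ^ 2 := by
    rw [← himg, gr_cov hPo (fun z hz => (hasDerivAt_inv hz.2).differentiableAt.differentiableWithinAt)
      inv_injective.injOn]
    have hPb : P =ᵐ[volume] ball (0:ℂ) 1 := sdiff_null_ae_eq_self (by simp)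
    rw [← setIntegral_congr_set hPb]
    apply setIntegral_congr_fun hPo.measurableSet
    intro z hz
    have h0 : z ≠ 0 := hz.2
    have := hg0 _ (hinv z hz.1 h0)
    simp only
    rw [(hFd z hz).deriv, hFe z h0, (hasDerivAt_inv h0).deriv, ← mul_pow, ← norm_mul, ← norm_neg]
    congr 2
    field_simp
  rw [hint]
  have hgpn : gp ≠ 0 := by
    rintro rfl
    simp at hgpF
  have hbn : ‖deriv F 0‖ = ‖gp‖⁻¹ := by
    rw [eq_inv_of_mul_eq_one_right hgpF, norm_inv]
  have hlog : - (2 * Real.pi * Real.log (‖deriv f 0‖ * ‖deriv F 0‖)) =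
      2 * Real.pi * Real.log ‖gp / deriv f 0‖ := by
    rw [hbn, norm_div, ← mul_neg, ← Real.log_inv]
    congr 2
    rw [mul_inv, inv_inv]
    ring
  rw [hlog] at key
  refine ⟨key, ?_⟩
  have hnn : 0 ≤ Real.log ‖gp / deriv f 0‖ := by
    have h1 : 0 ≤ 2 * Real.pi * Real.log ‖gp / deriv f 0‖ :=
      le_trans (add_nonneg (integral_nonneg fun z => by positivity)
        (integral_nonneg fun z => by positivity)) key
    have := Real.pi_pos
    exact nonneg_of_mul_nonneg_right h1 (by positivity)
  have hpos : 0 < ‖gp / deriv f 0‖ := norm_pos_iff.2 (div_ne_zero hgpn ha)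
  have := (Real.log_nonneg_iff hpos).1 hnn
  rw [norm_div, one_le_div (norm_pos_iff.2 ha)] at this
  exact this
end

section
/- Let f : 𝔻 → Ω be a conformal map onto a simply connected domain bounded by a Jordan curve γ ⊂ ℂ, with f(0) = z₀. Let Ep_Ω denote the Epstein–Poincaré map of Ω into the upper half-space model ℍ³ = ℂ × ℝ₊. Then the height coordinate ξ(z₀) of Ep_Ω(z₀) equals |f'(0)| / (1 + |f''(0)/(2f'(0))|²), and it satisfies d(z₀,γ)/5 ≤ ξ(z₀) ≤ 4·d(z₀,γ), where d denotes Euclidean distance. -/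
open Complex Metric Set

/-- A Jordan curve in `ℂ`: an injective continuous image of the circle `ℝ/ℤ`. -/
def IsJordanCurve (γ : Set ℂ) : Prop :=
  ∃ φ : AddCircle (1 : ℝ) → ℂ, Continuous φ ∧ Function.Injective φ ∧ Set.range φ = γ

/-- The Wirtinger derivative `∂φ/∂z̄` of a real-valued function of a complex variable. -/
noncomputable def wirtingerBar (φ : ℂ → ℝ) (z : ℂ) : ℂ :=
  ((((fderiv ℝ φ z) 1 : ℝ) : ℂ) + Complex.I * (((fderiv ℝ φ z) Complex.I : ℝ) : ℂ)) / 2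

/-- `ψ = φ_z̄ e^{-φ/2}` entering the upper half-space formula for the Epstein map. -/
noncomputable def epsteinPsi (φ : ℂ → ℝ) (z : ℂ) : ℂ :=
  wirtingerBar φ z * (Real.exp (-(φ z) / 2) : ℝ)

/-- The height coordinate `ξ = 2 e^{-φ/2}/(1 + |ψ|²)` of the Epstein map of the conformal
metric `e^φ |dz|²` in the upper half-space model. -/
noncomputable def epsteinXi (φ : ℂ → ℝ) (z : ℂ) : ℝ :=
  2 * Real.exp (-(φ z) / 2) / (1 + ‖epsteinPsi φ z‖ ^ 2)

/-- The Epstein map `z ↦ (Z, ξ) = (z + ξ ψ, ξ)` of the conformal metric `e^φ |dz|²`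
in the upper half-space model `ℍ³ = ℂ × ℝ₊`. -/
noncomputable def epsteinMap (φ : ℂ → ℝ) (z : ℂ) : ℂ × ℝ :=
  (z + (epsteinXi φ z : ℝ) * epsteinPsi φ z, epsteinXi φ z)

section aux
open MeasureTheory

lemma aux_volE (b : ℂ) (R : ℝ) (h : 2 * ‖b‖ ≤ R) :
    volume {w : ℂ | ‖w‖ ^ 2 - 2 * (b * (starRingEnd ℂ w) / w).re ≤ R} ≤
      ENNReal.ofReal (Real.pi * R) := by
  set E := {w : ℂ | ‖w‖ ^ 2 - 2 * (b * (starRingEnd ℂ w) / w).re ≤ R} with hE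
  have hEm : MeasurableSet E := by
    apply measurableSet_le _ measurable_const
    fun_prop
  set c : ℝ → ℝ := fun θ => R + 2 * (b.re * Real.cos (2 * θ) + b.im * Real.sin (2 * θ)) with hc
  have hcc : Continuous c := by fun_prop
  have hc0 : ∀ θ, 0 ≤ c θ := by
    intro θ
    have h1 : (b.re * Real.cos (2 * θ) + b.im * Real.sin (2 * θ)) ^ 2 ≤ ‖b‖ ^ 2 := by
      rw [Complex.sq_norm, Complex.normSq_apply]
      nlinarith [sq_nonneg (b.re * Real.sin (2 * θ) - b.im * Real.cos (2 * θ)),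
        Real.sin_sq_add_cos_sq (2 * θ)]
    have := abs_le_of_sq_le_sq' h1 (norm_nonneg b)
    simp only [hc]; linarith [this.1]
  have key : ∀ s θ : ℝ, 0 < s →
      (Complex.polarCoord.symm (s, θ) ∈ E ↔ s ≤ Real.sqrt (c θ)) := by
    intro s θ hs
    have hn : ‖Complex.polarCoord.symm (s, θ)‖ ^ 2 = s ^ 2 := by
      rw [Complex.norm_polarCoord_symm, sq_abs]
    have hr : (b * (starRingEnd ℂ (Complex.polarCoord.symm (s, θ))) /
        (Complex.polarCoord.symm (s, θ))).re
        = b.re * Real.cos (2 * θ) + b.im * Real.sin (2 * θ) := by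
      set w := Complex.polarCoord.symm (s, θ) with hw
      have hw0 : w ≠ 0 := by
        intro h0; rw [h0] at hn; exact (pow_pos hs 2).ne (by simpa using hn)
      have : b * (starRingEnd ℂ w) / w = b * (starRingEnd ℂ w) ^ 2 * ((s ^ 2 : ℝ) : ℂ)⁻¹ := by
        rw [← hn, ← Complex.normSq_eq_norm_sq, ← Complex.mul_conj]
        have : (starRingEnd ℂ w) ≠ 0 := by simpa using hw0
        field_simp
      rw [this, ← Complex.ofReal_inv, Complex.re_mul_ofReal]
      have hwr : w.re = s * Real.cos θ := by
        rw [hw]; simp [-ofReal_cos, -ofReal_sin]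
      have hwi : w.im = s * Real.sin θ := by
        rw [hw]; simp [-ofReal_cos, -ofReal_sin]
      rw [pow_two]
      simp only [Complex.mul_re, Complex.mul_im, Complex.conj_re, Complex.conj_im, hwr, hwi]
      rw [Real.cos_two_mul', Real.sin_two_mul]
      field_simp
      ring
    rw [hE, mem_ofPred_eq, hn, hr, Real.le_sqrt hs.le (hc0 θ)]
    simp only [hc]
    constructor <;> intro h <;> linarith
  have h1 : volume E = ∫⁻ w, E.indicator 1 w := by
    rw [lintegral_indicator_one hEm]
  rw [h1, ← Complex.lintegral_comp_polarCoord_symm, polarCoord_target,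
    Measure.volume_eq_prod, ← Measure.prod_restrict]
  rw [lintegral_prod_symm]
  swap
  · apply Measurable.aemeasurable
    apply Measurable.mul
    · fun_prop
    · apply (measurable_one.indicator hEm).comp
      have : (fun p : ℝ × ℝ => Complex.polarCoord.symm p) =
        fun p => (p.1:ℂ) * (Real.cos p.2 + Real.sin p.2 * Complex.I) := by
        ext p; rw [Complex.polarCoord_symm_apply]
      change Measurable (fun p : ℝ × ℝ => Complex.polarCoord.symm p)
      rw [this]; fun_prop
  have inner : ∀ θ : ℝ, ∫⁻ s in Ioi (0:ℝ), ENNReal.ofReal s •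
      E.indicator (1 : ℂ → ENNReal) (Complex.polarCoord.symm (s, θ)) = ENNReal.ofReal (c θ / 2) := by
    intro θ
    have e1 : ∫⁻ s in Ioi (0:ℝ), ENNReal.ofReal s •
      E.indicator (1 : ℂ → ENNReal) (Complex.polarCoord.symm (s, θ)) =
      ∫⁻ s in Ioi (0:ℝ), (Iic (Real.sqrt (c θ))).indicator (fun s => ENNReal.ofReal s) s := by
      apply setLIntegral_congr_fun measurableSet_Ioi
      intro s hs
      by_cases hm : s ≤ Real.sqrt (c θ)
      · have := (key s θ hs).2 hm
        simp only [Set.indicator_of_mem this, Set.indicator_of_mem (show s ∈ Iic _ from hm)]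
        simp
      · have : Complex.polarCoord.symm (s, θ) ∉ E := fun h => hm ((key s θ hs).1 h)
        simp only [Set.indicator_of_notMem this,
          Set.indicator_of_notMem (show s ∉ Iic (Real.sqrt (c θ)) from hm)]
        simp
    rw [e1, lintegral_indicator measurableSet_Iic, Measure.restrict_restrict measurableSet_Iic]
    rw [Set.inter_comm, Set.Ioi_inter_Iic]
    rw [← ofReal_integral_eq_lintegral_ofReal]
    · rw [← intervalIntegral.integral_of_le (Real.sqrt_nonneg _), integral_id, Real.sq_sqrt (hc0 θ)]
      simp
    · exact (continuous_id.integrableOn_Icc).mono_set Ioc_subset_Icc_self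
    · filter_upwards [ae_restrict_mem measurableSet_Ioc] with s hs using hs.1.le
  simp only [inner]
  rw [← ofReal_integral_eq_lintegral_ofReal]
  · apply ENNReal.ofReal_le_ofReal
    rw [← integral_Ioc_eq_integral_Ioo,
      ← intervalIntegral.integral_of_le (by linarith [Real.pi_pos])]
    have hd : ∀ θ ∈ Set.uIcc (-Real.pi) Real.pi, HasDerivAt (fun θ : ℝ => R * θ / 2 +
        (b.re * Real.sin (2 * θ) - b.im * Real.cos (2 * θ)) / 2) (c θ / 2) θ := by
      intro θ _
      have h2 : HasDerivAt (fun θ : ℝ => 2 * θ) 2 θ := by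
        simpa using (hasDerivAt_id θ).const_mul 2
      have := (((hasDerivAt_id θ).const_mul R).div_const 2).add
        (((h2.sin.const_mul b.re).sub (h2.cos.const_mul b.im)).div_const 2)
      convert! this using 1
      simp only [hc]; ring
    rw [intervalIntegral.integral_eq_sub_of_hasDerivAt hd
      ((hcc.div_const 2).intervalIntegrable _ _)]
    simp
    ring_nf
    exact le_rfl
  · exact ((hcc.div_const 2).integrableOn_Icc).mono_set Ioo_subset_Icc_self
  · exact Filter.Eventually.of_forall fun θ => by have := hc0 θ; simp only [Pi.zero_apply]; linarith

lemma aux_circ (m : ℂ → ℂ) (hm : DifferentiableOn ℂ m (ball 0 1)) (s : ℝ) (hs : 0 < s)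
    (hs1 : s < 1) :
    2 * Real.pi * (1 / s ^ 4 + ‖m 0‖ ^ 2) ≤
      ∫ θ in (-Real.pi)..Real.pi, ‖-1 / (circleMap 0 s θ) ^ 2 + m ((circleMap 0 s θ) ^ 2)‖ ^ 2 := by
  set b := m 0 with hb
  have hsq : ∀ z ∈ ball (0:ℂ) 1, z ^ 2 ∈ ball (0:ℂ) 1 := by
    intro z hz
    simp only [mem_ball_zero_iff, norm_pow] at *
    exact pow_lt_one₀ (norm_nonneg z) hz two_ne_zero
  set N : ℂ → ℂ := fun z => 2 * starRingEnd ℂ b * m (z ^ 2) - (2 / s ^ 4 : ℝ) * (z ^ 2 * m (z ^ 2))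
    with hN
  have hmz : DifferentiableOn ℂ (fun z : ℂ => m (z ^ 2)) (ball 0 1) :=
    hm.comp (by fun_prop) hsq
  have hNd : DifferentiableOn ℂ N (ball 0 1) := by
    apply DifferentiableOn.sub
    · exact hmz.const_mul _
    · exact ((differentiableOn_id.pow 2).mul hmz).const_mul _
  have hcl : closedBall (0:ℂ) s ⊆ ball 0 1 := closedBall_subset_ball hs1
  have hav : Real.circleAverage N 0 s = N 0 := by
    apply circleAverage_of_differentiable_on_off_countable (s := ∅) countable_empty
    · rw [abs_of_pos hs]; exact hNd.continuousOn.mono hcl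
    · rw [abs_of_pos hs]; intro z hz
      exact hNd.differentiableAt (isOpen_ball.mem_nhds (hcl (ball_subset_closedBall hz.1)))
  have hmem : ∀ θ, circleMap 0 s θ ∈ ball (0:ℂ) 1 := by
    intro θ; simp [abs_of_pos hs, hs1]
  have hcN : Continuous (fun θ => N (circleMap 0 s θ)) :=
    hNd.continuousOn.comp_continuous (continuous_circleMap _ _) hmem
  have hNint : ∫ θ in (-Real.pi)..Real.pi, N (circleMap 0 s θ) = 2 * Real.pi * (2 * ‖b‖ ^ 2 : ℝ) := by
    have hper : Function.Periodic (fun θ => N (circleMap 0 s θ)) (2 * Real.pi) :=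
      (periodic_circleMap 0 s).comp N
    have h1 := hper.intervalIntegral_add_eq (-Real.pi) 0
    rw [show -Real.pi + 2 * Real.pi = Real.pi by ring, zero_add] at h1
    rw [h1]
    rw [Real.circleAverage_def, inv_smul_eq_iff₀ (by positivity)] at hav
    rw [hav]
    simp only [hN]
    simp only [ne_eq, OfNat.ofNat_ne_zero, not_false_eq_true, zero_pow, zero_mul, mul_zero, sub_zero]
    rw [← hb, mul_assoc, mul_comm (starRingEnd ℂ b), Complex.mul_conj, Complex.normSq_eq_norm_sq]
    simp
  have hintre : ∫ θ in (-Real.pi)..Real.pi, (N (circleMap 0 s θ)).re = 2 * Real.pi * (2 * ‖b‖ ^ 2) := by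
    have := Complex.reCLM.intervalIntegral_comp_comm (hcN.intervalIntegrable (μ := volume) (-Real.pi) Real.pi)
    simp only [Complex.reCLM_apply] at this
    rw [this, hNint]
    rw [← Complex.ofReal_ofNat, ← Complex.ofReal_mul, ← Complex.ofReal_mul, Complex.ofReal_re]
  have hpt : ∀ θ, 1 / s ^ 4 - ‖b‖ ^ 2 + (N (circleMap 0 s θ)).re ≤
      ‖-1 / (circleMap 0 s θ) ^ 2 + m ((circleMap 0 s θ) ^ 2)‖ ^ 2 := by
    intro θ
    set z := circleMap 0 s θ with hz
    have hzn : ‖z ^ 2‖ ^ 2 = s ^ 4 := by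
      rw [hz, norm_pow, norm_circleMap_zero, sq_abs]; ring
    set u := z ^ 2 with hu
    have hinv : -1 / u = -((1 / s ^ 4 : ℝ) * starRingEnd ℂ u) := by
      have hu0 : u ≠ 0 := by
        intro h; rw [h] at hzn; exact (pow_pos hs 4).ne (by simpa using hzn)
      rw [← hzn, ← Complex.normSq_eq_norm_sq, Complex.ofReal_div, ← Complex.mul_conj]
      have : (starRingEnd ℂ u) ≠ 0 := by simpa using hu0
      simp; field_simp
    rw [hinv]
    simp only [hN, ← hu]
    generalize m u = M
    have hu4 : u.re * u.re + u.im * u.im = s ^ 4 := by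
      rw [← hzn, Complex.sq_norm, Complex.normSq_apply]
    have ht : (1 / s ^ 4) * s ^ 4 = 1 := by field_simp
    have ht2 : 2 / s ^ 4 = 2 * (1 / s ^ 4) := by ring
    rw [ht2]
    generalize 1 / s ^ 4 = t at *
    rw [Complex.sq_norm, Complex.sq_norm, Complex.normSq_apply, Complex.normSq_apply]
    simp [Complex.add_re, Complex.mul_re]
    rw [← hu4] at ht
    have e : t = t * (t * (u.re * u.re + u.im * u.im)) := by rw [ht, mul_one]
    nlinarith [sq_nonneg (M.re - b.re), sq_nonneg (M.im - b.im)]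
  have hcm : Continuous fun θ => ‖-1 / (circleMap 0 s θ) ^ 2 + m ((circleMap 0 s θ) ^ 2)‖ ^ 2 := by
    have h1 : Continuous fun θ => m ((circleMap 0 s θ) ^ 2) :=
      hmz.continuousOn.comp_continuous (continuous_circleMap _ _) hmem
    have h2 : Continuous fun θ => -1 / (circleMap 0 s θ) ^ 2 := by
      apply Continuous.div continuous_const ((continuous_circleMap _ _).pow 2)
      intro θ; exact pow_ne_zero _ (circleMap_ne_center hs.ne')
    exact (h2.add h1).norm.pow 2
  have hre : Continuous fun θ => (N (circleMap 0 s θ)).re := Complex.continuous_re.comp hcN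
  calc 2 * Real.pi * (1 / s ^ 4 + ‖b‖ ^ 2)
      = ∫ θ in (-Real.pi)..Real.pi, (1 / s ^ 4 - ‖b‖ ^ 2 + (N (circleMap 0 s θ)).re) := by
        rw [intervalIntegral.integral_add (by simp) (hre.intervalIntegrable _ _), hintre]
        simp; ring
    _ ≤ _ := by
        apply intervalIntegral.integral_mono_on (by linarith [Real.pi_pos])
        · exact (continuous_const.add hre).intervalIntegrable _ _
        · exact hcm.intervalIntegrable _ _
        · intro θ _; exact hpt θ

lemma aux_area_lower (m : ℂ → ℂ) (hm : DifferentiableOn ℂ m (ball 0 1)) (ε ρ : ℝ) (hε : 0 < ε)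
    (hερ : ε < ρ) (hρ : ρ < 1) :
    ENNReal.ofReal (Real.pi * (1 / ε ^ 2 - 1 / ρ ^ 2) + Real.pi * ‖m 0‖ ^ 2 * (ρ ^ 2 - ε ^ 2)) ≤
      ∫⁻ z in {z : ℂ | ε < ‖z‖ ∧ ‖z‖ < ρ}, ENNReal.ofReal (‖-1 / z ^ 2 + m (z ^ 2)‖ ^ 2) := by
  set A := {z : ℂ | ε < ‖z‖ ∧ ‖z‖ < ρ} with hA
  have hAo : IsOpen A :=
    (isOpen_lt continuous_const continuous_norm).inter (isOpen_lt continuous_norm continuous_const)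
  set D : ℂ → ENNReal := fun z => ENNReal.ofReal (‖-1 / z ^ 2 + m (z ^ 2)‖ ^ 2) with hD
  have hcont : ContinuousOn (fun z : ℂ => ‖-1 / z ^ 2 + m (z ^ 2)‖ ^ 2) (ball 0 1 \ {0}) := by
    have h1 : ContinuousOn (fun z : ℂ => m (z ^ 2)) (ball 0 1 \ {0}) := by
      apply hm.continuousOn.comp (by fun_prop)
      intro z hz
      have := hz.1
      simp only [mem_ball_zero_iff, norm_pow] at *
      exact pow_lt_one₀ (norm_nonneg z) this two_ne_zero
    apply ContinuousOn.pow
    apply ContinuousOn.norm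
    apply ContinuousOn.add _ h1
    apply ContinuousOn.div continuousOn_const (by fun_prop)
    intro z hz; exact pow_ne_zero _ hz.2
  have hAs : A ⊆ ball 0 1 \ {0} := by
    intro z hz
    refine ⟨by simpa using hz.2.trans hρ, ?_⟩
    intro h; rw [mem_singleton_iff] at h
    have := hz.1; rw [h] at this; simp at this; linarith
  have hmeas : Measurable (A.indicator D) := by
    have hDc : ContinuousOn D A :=
      ENNReal.continuous_ofReal.comp_continuousOn (hcont.mono hAs)
    have := hDc.measurable_piecewise (g := fun _ => 0) continuousOn_const hAo.measurableSet
    rw [← Set.piecewise_eq_indicator]; exact this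
  rw [← lintegral_indicator hAo.measurableSet, ← Complex.lintegral_comp_polarCoord_symm,
    polarCoord_target, Measure.volume_eq_prod, ← Measure.prod_restrict]
  have hsymm : ∀ p : ℝ × ℝ, Complex.polarCoord.symm p = circleMap 0 p.1 p.2 := by
    intro p; rw [Complex.polarCoord_symm_apply, circleMap_zero, Complex.exp_mul_I]; simp
  rw [lintegral_prod]
  swap
  · apply Measurable.aemeasurable
    apply Measurable.mul
    · fun_prop
    · apply hmeas.comp
      have : (fun p : ℝ × ℝ => Complex.polarCoord.symm p) =
        fun p => (p.1:ℂ) * (Real.cos p.2 + Real.sin p.2 * Complex.I) := by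
        ext p; rw [Complex.polarCoord_symm_apply]
      change Measurable (fun p : ℝ × ℝ => Complex.polarCoord.symm p)
      rw [this]; fun_prop
  have inner : ∀ s ∈ Ioo ε ρ, ENNReal.ofReal (2 * Real.pi * (1 / s ^ 3 + ‖m 0‖ ^ 2 * s)) ≤
      ∫⁻ θ in Ioo (-Real.pi) Real.pi, ENNReal.ofReal s •
        A.indicator D (Complex.polarCoord.symm (s, θ)) := by
    intro s hs
    have hs0 : 0 < s := hε.trans hs.1
    have hin : ∀ θ, Complex.polarCoord.symm (s, θ) ∈ A := by
      intro θ
      rw [hA, mem_ofPred_eq, Complex.norm_polarCoord_symm, abs_of_pos hs0]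
      exact hs
    have e : ∀ θ, ENNReal.ofReal s • A.indicator D (Complex.polarCoord.symm (s, θ)) =
        ENNReal.ofReal (s * ‖-1 / (circleMap 0 s θ) ^ 2 + m ((circleMap 0 s θ) ^ 2)‖ ^ 2) := by
      intro θ
      rw [Set.indicator_of_mem (hin θ), hsymm, hD, ENNReal.ofReal_mul hs0.le]
      rfl
    simp only [e]
    have hc : Continuous fun θ =>
        s * ‖-1 / (circleMap 0 s θ) ^ 2 + m ((circleMap 0 s θ) ^ 2)‖ ^ 2 := by
      apply continuous_const.mul
      apply hcont.comp_continuous (continuous_circleMap _ _)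
      intro θ; apply hAs; have := hin θ; rwa [hsymm] at this
    rw [← ofReal_integral_eq_lintegral_ofReal]
    · apply ENNReal.ofReal_le_ofReal
      rw [← integral_Ioc_eq_integral_Ioo,
        ← intervalIntegral.integral_of_le (by linarith [Real.pi_pos]),
        intervalIntegral.integral_const_mul]
      have := mul_le_mul_of_nonneg_left (aux_circ m hm s hs0 (hs.2.trans hρ)) hs0.le
      refine le_trans (le_of_eq ?_) this
      field_simp
    · exact hc.integrableOn_Icc.mono_set Ioo_subset_Icc_self
    · exact Filter.Eventually.of_forall fun θ => by simp only [Pi.zero_apply]; positivity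
  have hc3 : ContinuousOn (fun s : ℝ => 2 * Real.pi * (1 / s ^ 3 + ‖m 0‖ ^ 2 * s)) (Icc ε ρ) := by
    apply ContinuousOn.mul continuousOn_const
    apply ContinuousOn.add _ (by fun_prop)
    apply ContinuousOn.div continuousOn_const (by fun_prop)
    intro s hs; exact pow_ne_zero _ (hε.trans_le hs.1).ne'
  calc ENNReal.ofReal (Real.pi * (1 / ε ^ 2 - 1 / ρ ^ 2) + Real.pi * ‖m 0‖ ^ 2 * (ρ ^ 2 - ε ^ 2))
      = ∫⁻ s in Ioo ε ρ, ENNReal.ofReal (2 * Real.pi * (1 / s ^ 3 + ‖m 0‖ ^ 2 * s)) := by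
        rw [← ofReal_integral_eq_lintegral_ofReal]
        · congr 1
          rw [← integral_Ioc_eq_integral_Ioo, ← intervalIntegral.integral_of_le hερ.le]
          have hd : ∀ s ∈ Set.uIcc ε ρ, HasDerivAt
              (fun s : ℝ => -Real.pi * (s ^ 2)⁻¹ + Real.pi * ‖m 0‖ ^ 2 * s ^ 2)
              (2 * Real.pi * (1 / s ^ 3 + ‖m 0‖ ^ 2 * s)) s := by
            intro s hs
            rw [uIcc_of_le hερ.le] at hs
            have hs0 : s ≠ 0 := (hε.trans_le hs.1).ne'
            have h2 := (hasDerivAt_pow 2 s)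
            have := ((h2.inv (pow_ne_zero 2 hs0)).const_mul (-Real.pi)).add
              (h2.const_mul (Real.pi * ‖m 0‖ ^ 2))
            convert! this using 1
            simp; field_simp
          rw [intervalIntegral.integral_eq_sub_of_hasDerivAt hd]
          · ring
          · apply ContinuousOn.intervalIntegrable; rwa [uIcc_of_le hερ.le]
        · exact (hc3.integrableOn_Icc).mono_set Ioo_subset_Icc_self
        · filter_upwards [ae_restrict_mem measurableSet_Ioo] with s hs
          have : 0 < s := hε.trans hs.1
          simp only [Pi.zero_apply]; positivity
    _ ≤ ∫⁻ s in Ioo ε ρ, ∫⁻ θ in Ioo (-Real.pi) Real.pi, ENNReal.ofReal s •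
        A.indicator D (Complex.polarCoord.symm (s, θ)) :=
        setLIntegral_mono' measurableSet_Ioo inner
    _ ≤ _ := lintegral_mono_set (fun s hs => hε.trans hs.1)

/-- Area theorem, in the form needed for odd univalent functions. -/
lemma aux_area (q : ℂ → ℂ) (hq : DifferentiableOn ℂ q (ball 0 1)) (hq0 : q 0 = 1)
    (hqn : ∀ z ∈ ball (0:ℂ) 1, q z ≠ 0)
    (hinj : InjOn (fun z => q (z ^ 2) / z) (ball 0 1 \ {0})) : ‖deriv q 0‖ ≤ 1 := by
  set b := deriv q 0 with hb
  set p := dslope q 0 with hp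
  have h0 : (0:ℂ) ∈ ball (0:ℂ) 1 := by simp
  have hnh : ∀ z ∈ ball (0:ℂ) 1, ball (0:ℂ) 1 ∈ nhds z := fun z hz => isOpen_ball.mem_nhds hz
  have hpd : DifferentiableOn ℂ p (ball 0 1) := (differentiableOn_dslope (hnh 0 h0)).2 hq
  have hp0 : p 0 = b := dslope_same q 0
  have hqp : ∀ u, q u = 1 + u * p u := by
    intro u
    have := sub_smul_dslope q 0 u
    simp only [sub_zero, smul_eq_mul, hq0] at this
    rw [hp, this]; ring
  have hsq : ∀ z ∈ ball (0:ℂ) 1, z ^ 2 ∈ ball (0:ℂ) 1 := by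
    intro z hz
    simp only [mem_ball_zero_iff, norm_pow] at *
    exact pow_lt_one₀ (norm_nonneg z) hz two_ne_zero
  set m : ℂ → ℂ := fun u => 2 * deriv q u - p u with hm
  have hmd : DifferentiableOn ℂ m (ball 0 1) :=
    ((hq.deriv isOpen_ball).const_mul 2).sub hpd
  have hm0 : m 0 = b := by simp only [hm, hp0]; rw [← hb]; ring
  set G : ℂ → ℂ := fun z => q (z ^ 2) / z with hG
  have hGd : ∀ z ∈ ball (0:ℂ) 1 \ {0}, HasDerivAt G (-1 / z ^ 2 + m (z ^ 2)) z := by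
    intro z hz
    have hz0 : z ≠ 0 := hz.2
    have h1 : HasDerivAt q (deriv q (z ^ 2)) (z ^ 2) :=
      (hq.differentiableAt (hnh _ (hsq z hz.1))).hasDerivAt
    have h2 : HasDerivAt (fun z : ℂ => z ^ 2) (2 * z) z := by simpa using hasDerivAt_pow 2 z
    have h3 := (h1.comp z h2).div (hasDerivAt_id z) hz0
    convert! h3 using 1
    simp only [hm, Function.comp, id]
    rw [hqp (z ^ 2)]
    field_simp
    ring
  -- the upper bound for the distorted square modulus
  set T : ℂ → ℝ := fun u => 2 * ‖p u - b * (starRingEnd ℂ (q u)) / q u‖ + ‖u‖ * ‖p u‖ ^ 2 with hT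
  have hTc : ContinuousOn T (ball 0 1) := by
    have hpc := hpd.continuousOn
    have hqc := hq.continuousOn
    apply ContinuousOn.add
    · apply ContinuousOn.mul continuousOn_const
      apply ContinuousOn.norm
      apply hpc.sub
      apply ContinuousOn.div _ hqc hqn
      exact continuousOn_const.mul (Complex.continuous_conj.comp_continuousOn hqc)
    · exact continuousOn_id.norm.mul (hpc.norm.pow 2)
  have hT0 : T 0 = 0 := by simp [hT, hp0, hq0]
  have hV : ∀ z ∈ ball (0:ℂ) 1 \ {0},
      ‖G z‖ ^ 2 - 2 * (b * (starRingEnd ℂ (G z)) / G z).re ≤ 1 / ‖z‖ ^ 2 + T (z ^ 2) := by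
    intro z hz
    have hz0 : z ≠ 0 := hz.2
    have hz1 : (starRingEnd ℂ z) ≠ 0 := by simpa using hz0
    have hQ := hqn _ (hsq z hz.1)
    have e1 : b * (starRingEnd ℂ (G z)) / G z =
        (z / starRingEnd ℂ z) * (b * starRingEnd ℂ (q (z ^ 2)) / q (z ^ 2)) := by
      simp only [hG, map_div₀]; field_simp
    have e2 : ‖G z‖ ^ 2 = 1 / ‖z‖ ^ 2 + 2 * ((z / starRingEnd ℂ z) * p (z ^ 2)).re
        + ‖z ^ 2‖ * ‖p (z ^ 2)‖ ^ 2 := by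
      have hGz : G z = 1 / z + z * p (z ^ 2) := by
        simp only [hG]; rw [hqp]; field_simp
      have e3 : (z / starRingEnd ℂ z) * p (z ^ 2) = starRingEnd ℂ (1 / z) * (z * p (z ^ 2)) := by
        simp only [map_div₀, map_one]; field_simp
      have e4 : 1 / ‖z‖ ^ 2 = ‖1 / z‖ ^ 2 := by rw [norm_div]; simp
      have e5 : ‖z ^ 2‖ * ‖p (z ^ 2)‖ ^ 2 = ‖z * p (z ^ 2)‖ ^ 2 := by
        rw [norm_mul, norm_pow]; ring
      rw [hGz, e3, e4, e5]
      generalize 1 / z = x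
      generalize z * p (z ^ 2) = y
      simp only [Complex.sq_norm, Complex.normSq_apply, Complex.mul_re, Complex.add_re,
        Complex.add_im, Complex.conj_re, Complex.conj_im]
      ring
    have hun : ‖z / starRingEnd ℂ z‖ = 1 := by
      rw [norm_div, Complex.norm_conj, div_self (by simpa using hz0)]
    have e6 : ((z / starRingEnd ℂ z) * p (z ^ 2)).re -
        ((z / starRingEnd ℂ z) * (b * starRingEnd ℂ (q (z ^ 2)) / q (z ^ 2))).re ≤
        ‖p (z ^ 2) - b * (starRingEnd ℂ (q (z ^ 2))) / q (z ^ 2)‖ := by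
      rw [← Complex.sub_re, ← mul_sub]
      refine (Complex.re_le_norm _).trans ?_
      rw [norm_mul, hun, one_mul]
    rw [e1, e2]
    simp only [hT]
    linarith
  -- the main inequality
  have main : ∀ ρ : ℝ, 0 < ρ → ρ < 1 → ∀ η : ℝ, 0 < η → ∃ ε₀ > 0, ∀ ε : ℝ, 0 < ε → ε < ε₀ →
      ‖b‖ ^ 2 * (ρ ^ 2 - ε ^ 2) ≤ 1 / ρ ^ 2 + η := by
    intro ρ hρ0 hρ1 η hη
    have hTat : ContinuousAt (fun z : ℂ => T (z ^ 2)) 0 := by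
      apply ContinuousAt.comp (f := fun z : ℂ => z ^ 2) (g := T)
      · simpa using hTc.continuousAt (hnh 0 h0)
      · fun_prop
    obtain ⟨δ, hδ, hTδ⟩ := Metric.continuousAt_iff.1 hTat η hη
    have hbd : ∃ K, ∀ z ∈ closedBall (0:ℂ) ρ, ‖T (z ^ 2)‖ ≤ K := by
      apply (isCompact_closedBall (0:ℂ) ρ).exists_bound_of_continuousOn
      apply hTc.comp (by fun_prop)
      intro z hz
      exact hsq z (closedBall_subset_ball hρ1 hz)
    obtain ⟨K, hK⟩ := hbd
    have hlim : Filter.Tendsto (fun ε : ℝ => (ε ^ 2)⁻¹) (nhdsWithin 0 (Ioi 0)) Filter.atTop := by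
      have := (tendsto_inv_nhdsGT_zero (𝕜 := ℝ))
      have h2 := (Filter.tendsto_pow_atTop (α := ℝ) two_ne_zero).comp this
      refine h2.congr fun x => by simp
    have hev := (hlim.eventually_ge_atTop (max (1 / δ ^ 2 + K) (2 * ‖b‖)))
    rw [eventually_nhdsWithin_iff, Metric.eventually_nhds_iff] at hev
    obtain ⟨ε₁, hε₁, hev⟩ := hev
    refine ⟨min ε₁ ρ, lt_min hε₁ hρ0, ?_⟩
    intro ε hε hεlt
    have hερ : ε < ρ := hεlt.trans_le (min_le_right _ _)
    have hbig := hev (y := ε) (by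
      rw [Real.dist_eq, sub_zero, abs_of_pos hε]; exact hεlt.trans_le (min_le_left _ _)) hε
    have hbig1 := (le_max_left _ _).trans hbig
    have hbig2 := (le_max_right _ _).trans hbig
    set A := {z : ℂ | ε < ‖z‖ ∧ ‖z‖ < ρ} with hA
    have hAo : IsOpen A := (isOpen_lt continuous_const continuous_norm).inter
      (isOpen_lt continuous_norm continuous_const)
    have hAs : A ⊆ ball 0 1 \ {0} := by
      intro z hz
      refine ⟨by simpa using hz.2.trans hρ1, ?_⟩
      intro h; rw [mem_singleton_iff] at h
      have := hz.1; rw [h] at this; simp at this; linarith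
    set R : ℝ := (ε ^ 2)⁻¹ + η with hR
    have hsub : G '' A ⊆ {w : ℂ | ‖w‖ ^ 2 - 2 * (b * (starRingEnd ℂ w) / w).re ≤ R} := by
      rintro _ ⟨z, hz, rfl⟩
      rw [mem_ofPred_eq]
      refine (hV z (hAs hz)).trans ?_
      by_cases hzδ : ‖z‖ < δ
      · have h1 := hTδ (x := z) (by simpa using hzδ)
        rw [Real.dist_eq] at h1
        have h2 := (abs_lt.1 h1).2
        simp only [ne_eq, OfNat.ofNat_ne_zero, not_false_eq_true, zero_pow, hT0] at h2
        have h3 : 1 / ‖z‖ ^ 2 ≤ (ε ^ 2)⁻¹ := by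
          rw [one_div]
          apply inv_anti₀ (by positivity)
          exact pow_le_pow_left₀ hε.le hz.1.le 2
        linarith
      · push Not at hzδ
        have h1 := hK z (by simpa using hz.2.le)
        have h2 := (Real.le_norm_self _).trans h1
        have h3 : 1 / ‖z‖ ^ 2 ≤ 1 / δ ^ 2 := by
          apply one_div_le_one_div_of_le (by positivity)
          exact pow_le_pow_left₀ hδ.le hzδ 2
        linarith
    have hvol := (measure_mono (μ := volume) hsub).trans (aux_volE b R (by linarith))
    have hcv := lintegral_abs_det_fderiv_eq_addHaar_image volume (f := G)
      (f' := fun z => ((ContinuousLinearMap.toSpanSingleton ℂ (-1 / z ^ 2 + m (z ^ 2))).restrictScalars ℝ))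
      hAo.measurableSet
      (fun z hz => ((hGd z (hAs hz)).hasFDerivAt.restrictScalars ℝ).hasFDerivWithinAt)
      (hinj.mono hAs)
    have hdet : ∀ c : ℂ,
        |((ContinuousLinearMap.toSpanSingleton ℂ c).restrictScalars ℝ : ℂ →L[ℝ] ℂ).det| = ‖c‖ ^ 2 := by
      intro c
      have : ((ContinuousLinearMap.toSpanSingleton ℂ c).restrictScalars ℝ : ℂ →L[ℝ] ℂ).det = ‖c‖ ^ 2 := by
        rw [ContinuousLinearMap.det, ← LinearMap.det_toMatrix Complex.basisOneI, Matrix.det_fin_two]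
        simp [LinearMap.toMatrix_apply, Complex.sq_norm, Complex.normSq_apply]
      rw [this, abs_of_nonneg (by positivity)]
    simp only [hdet] at hcv
    have hlow := aux_area_lower m hmd ε ρ hε hερ hρ1
    rw [← hA, hcv] at hlow
    have hfin := hlow.trans hvol
    rw [ENNReal.ofReal_le_ofReal_iff (by positivity), hm0, hR] at hfin
    have hpi := Real.pi_pos
    have h5 : Real.pi * (1 / ε ^ 2 - 1 / ρ ^ 2 + ‖b‖ ^ 2 * (ρ ^ 2 - ε ^ 2)) ≤
        Real.pi * ((ε ^ 2)⁻¹ + η) := by linarith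
    have h6 := le_of_mul_le_mul_left h5 hpi
    rw [one_div (ε ^ 2)] at h6
    linarith
  -- let the parameters tend to their limits
  have main2 : ∀ ρ : ℝ, 0 < ρ → ρ < 1 → ‖b‖ ^ 2 * ρ ^ 2 ≤ 1 / ρ ^ 2 := by
    intro ρ h0 h1
    apply le_of_forall_pos_le_add
    intro η hη
    obtain ⟨ε₀, hε₀, h⟩ := main ρ h0 h1 η hη
    have ht : Filter.Tendsto (fun ε : ℝ => ‖b‖ ^ 2 * (ρ ^ 2 - ε ^ 2)) (nhdsWithin 0 (Ioi 0))
        (nhds (‖b‖ ^ 2 * ρ ^ 2)) := by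
      have : Continuous (fun ε : ℝ => ‖b‖ ^ 2 * (ρ ^ 2 - ε ^ 2)) := by fun_prop
      have h2 := (this.tendsto 0).mono_left (nhdsWithin_le_nhds (s := Ioi (0:ℝ)))
      simpa using h2
    apply le_of_tendsto ht
    filter_upwards [Ioo_mem_nhdsGT hε₀] with ε hε using h ε hε.1 hε.2
  have main3 : ‖b‖ ^ 2 ≤ 1 := by
    have t1 : Filter.Tendsto (fun ρ : ℝ => ‖b‖ ^ 2 * ρ ^ 4) (nhdsWithin 1 (Iio 1))
        (nhds (‖b‖ ^ 2)) := by
      have : Continuous (fun ρ : ℝ => ‖b‖ ^ 2 * ρ ^ 4) := by fun_prop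
      have h2 := (this.tendsto 1).mono_left (nhdsWithin_le_nhds (s := Iio (1:ℝ)))
      simpa using h2
    apply le_of_tendsto t1
    filter_upwards [Ioo_mem_nhdsLT (zero_lt_one' ℝ)] with ρ hρ
    have h := main2 ρ hρ.1 hρ.2
    rw [le_div_iff₀ (pow_pos hρ.1 2)] at h
    nlinarith
  exact (sq_le_one_iff₀ (norm_nonneg b)).1 main3

/-- Bieberbach's inequality for the second coefficient. -/
lemma aux_bieberbach (f : ℂ → ℂ) (hf : DifferentiableOn ℂ f (ball 0 1))
    (hinj : InjOn f (ball 0 1)) (hf' : deriv f 0 ≠ 0) :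
    ‖deriv (deriv f) 0‖ ≤ 4 * ‖deriv f 0‖ := by
  set u := dslope f 0 with hu
  have h0 : (0:ℂ) ∈ ball (0:ℂ) 1 := by simp
  have hnh : ∀ z ∈ ball (0:ℂ) 1, ball (0:ℂ) 1 ∈ nhds z := fun z hz => isOpen_ball.mem_nhds hz
  have hud : DifferentiableOn ℂ u (ball 0 1) := (differentiableOn_dslope (hnh 0 h0)).2 hf
  have hu0 : u 0 = deriv f 0 := dslope_same f 0
  have hfu : ∀ z, f z = f 0 + z * u z := by
    intro z
    have := sub_smul_dslope f 0 z
    simp only [sub_zero, smul_eq_mul] at this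
    rw [hu, this]; ring
  have hun : ∀ z ∈ ball (0:ℂ) 1, u z ≠ 0 := by
    intro z hz h
    by_cases hz0 : z = 0
    · rw [hz0, hu0] at h; exact hf' h
    · apply hz0
      apply hinj hz h0
      rw [hfu z, h]; simp
  have hu'd : DifferentiableOn ℂ (deriv u) (ball 0 1) := hud.deriv isOpen_ball
  obtain ⟨P, hP0, hP⟩ := (DifferentiableOn.isExactOn_ball (hu'd.div hud hun)).with_val_at 0 0
  set q : ℂ → ℂ := fun z => Complex.exp (-(P z) / 2) with hq
  have hqd : ∀ z ∈ ball (0:ℂ) 1,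
      HasDerivAt q (Complex.exp (-(P z) / 2) * (-(deriv u z / u z) / 2)) z := by
    intro z hz
    exact (((hP z hz).neg).div_const 2).cexp
  have hq0 : q 0 = 1 := by simp [hq, hP0]
  have hqu : ∀ z ∈ ball (0:ℂ) 1, u z * q z ^ 2 = u 0 := by
    intro z hz
    have hd : ∀ w ∈ ball (0:ℂ) 1, HasDerivAt (fun w => u w * q w ^ 2) 0 w := by
      intro w hw
      have h1 := (hud.differentiableAt (hnh w hw)).hasDerivAt
      have h2 := h1.mul ((hqd w hw).pow 2)
      convert! h2 using 1
      have := hun w hw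
      simp only [hq, Pi.pow_apply]
      field_simp
      ring
    have := (convex_ball (0:ℂ) 1).is_const_of_fderivWithin_eq_zero (𝕜 := ℂ)
      (f := fun w => u w * q w ^ 2) (fun w hw => (hd w hw).differentiableAt.differentiableWithinAt)
      (fun w hw => by
        rw [fderivWithin_of_isOpen isOpen_ball hw, (hd w hw).hasFDerivAt.fderiv]
        ext; simp) hz h0
    simpa [hq0] using this
  have hinjG : InjOn (fun z => q (z ^ 2) / z) (ball 0 1 \ {0}) := by
    intro z hz w hw hzw
    have hsq : ∀ z ∈ ball (0:ℂ) 1, z ^ 2 ∈ ball (0:ℂ) 1 := by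
      intro z hz
      simp only [mem_ball_zero_iff, norm_pow] at *
      exact pow_lt_one₀ (norm_nonneg z) hz two_ne_zero
    have hz0 : z ≠ 0 := hz.2
    have hw0 : w ≠ 0 := hw.2
    have hqz : q (z ^ 2) ≠ 0 := Complex.exp_ne_zero _
    have hqw : q (w ^ 2) ≠ 0 := Complex.exp_ne_zero _
    simp only at hzw
    have e : ∀ z ∈ ball (0:ℂ) 1 \ {0}, f (z ^ 2) = f 0 + u 0 / (q (z ^ 2) / z) ^ 2 := by
      intro z hz
      have hz0 : z ≠ 0 := hz.2
      have hqz : q (z ^ 2) ≠ 0 := Complex.exp_ne_zero _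
      rw [hfu (z ^ 2), ← hqu _ (hsq z hz.1)]
      field_simp
    have hff : f (z ^ 2) = f (w ^ 2) := by rw [e z hz, e w hw, hzw]
    have h2 := hinj (hsq z hz.1) (hsq w hw.1) hff
    rw [h2, div_eq_div_iff hz0 hw0] at hzw
    exact (mul_left_cancel₀ hqw hzw).symm
  have hfin := aux_area q (fun z hz => (hqd z hz).differentiableAt.differentiableWithinAt) hq0
    (fun z _ => Complex.exp_ne_zero _) hinjG
  rw [(hqd 0 h0).deriv, hP0] at hfin
  have hu1 : deriv (deriv f) 0 = 2 * deriv u 0 := by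
    have h1 : deriv f =ᶠ[nhds 0] fun z => u z + z * deriv u z := by
      filter_upwards [hnh 0 h0] with z hz
      have h2 := ((hasDerivAt_id z).mul (hud.differentiableAt (hnh z hz)).hasDerivAt).const_add (f 0)
      have h3 : f = fun z => f 0 + id z * u z := by ext z; exact hfu z
      have h4 : HasDerivAt f (1 * u z + id z * deriv u z) z := by
        rw [h3]; exact h2
      rw [h4.deriv]; simp
    rw [h1.deriv_eq]
    have h2 := (hud.differentiableAt (hnh 0 h0)).hasDerivAt
    have h3 := (hu'd.differentiableAt (hnh 0 h0)).hasDerivAt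
    have h4 := h2.add ((hasDerivAt_id 0).mul h3)
    have h5 : HasDerivAt (fun z => u z + z * deriv u z) (deriv u 0 + (1 * deriv u 0 + id 0 * deriv (deriv u) 0)) 0 := h4
    rw [h5.deriv]; simp; ring
  rw [hu1]
  rw [hu0] at hfin
  simp only [neg_zero, zero_div, Complex.exp_zero, one_mul, norm_div, norm_neg, Complex.norm_ofNat] at hfin
  have hpos : 0 < ‖deriv f 0‖ := norm_pos_iff.2 hf'
  rw [div_div, div_le_one (by positivity)] at hfin
  rw [norm_mul, Complex.norm_ofNat]
  linarith

lemma aux_inv (f : ℂ → ℂ) (hf : DifferentiableOn ℂ f (ball 0 1))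
    (hinj : InjOn f (ball 0 1)) (z : ℂ) (hz : z ∈ ball (0:ℂ) 1) (hf' : deriv f z ≠ 0) :
    HasDerivAt (Function.invFunOn f (ball 0 1)) (deriv f z)⁻¹ (f z) := by
  have hs : HasStrictDerivAt f (deriv f z) z :=
    (hf.analyticAt (isOpen_ball.mem_nhds hz)).hasStrictDerivAt
  have h1 := (hs.to_localInverse hf').hasDerivAt
  apply h1.congr_of_eventuallyEq
  have h2 := hs.eventually_right_inverse hf'
  have h3 : ∀ᶠ y in nhds (f z), hs.localInverse f _ z hf' y ∈ ball (0:ℂ) 1 := by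
    have hc := h1.continuousAt
    have he : hs.localInverse f _ z hf' (f z) = z := by
      exact HasStrictFDerivAt.localInverse_apply_image _
    apply hc.eventually_mem
    rw [he]; exact isOpen_ball.mem_nhds hz
  filter_upwards [h2, h3] with y hy2 hy3
  have hex : ∃ a ∈ ball (0:ℂ) 1, f a = y := ⟨_, hy3, hy2⟩
  apply hinj (Function.invFunOn_mem hex) hy3
  rw [Function.invFunOn_eq hex, hy2]

lemma aux_dist_le (f : ℂ → ℂ) (hf : DifferentiableOn ℂ f (ball 0 1))
    (hinj : InjOn f (ball 0 1)) (hf' : ∀ z ∈ ball (0:ℂ) 1, deriv f z ≠ 0) (d : ℝ) (hd : 0 < d)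
    (hsub : ball (f 0) d ⊆ f '' ball 0 1) : d ≤ ‖deriv f 0‖ := by
  have h0 : (0:ℂ) ∈ ball (0:ℂ) 1 := by simp
  set g := Function.invFunOn f (ball 0 1) with hg
  have hg0 : g (f 0) = 0 := hinj (Function.invFunOn_mem ⟨0, h0, rfl⟩) h0
    (Function.invFunOn_eq ⟨0, h0, rfl⟩)
  have hgd : DifferentiableOn ℂ g (ball (f 0) d) := by
    intro y hy
    obtain ⟨z, hz, rfl⟩ := hsub hy
    exact (aux_inv f hf hinj z hz (hf' z hz)).differentiableAt.differentiableWithinAt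
  have hmaps : MapsTo g (ball (f 0) d) (ball (g (f 0)) 1) := by
    intro y hy
    rw [hg0]
    exact Function.invFunOn_mem (hsub hy)
  have := Complex.norm_deriv_le_div_of_mapsTo_ball hgd (hmaps.mono_right ball_subset_closedBall) hd
  rw [(aux_inv f hf hinj 0 h0 (hf' 0 h0)).deriv, norm_inv, ← one_div] at this
  exact (one_div_le_one_div (norm_pos_iff.2 (hf' 0 h0)) hd).1 this

lemma aux_koebe (f : ℂ → ℂ) (hf : DifferentiableOn ℂ f (ball 0 1))
    (hinj : InjOn f (ball 0 1)) (hf' : deriv f 0 ≠ 0) (w : ℂ) (hw : w ∉ f '' ball 0 1) :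
    ‖deriv f 0‖ ≤ 4 * ‖w - f 0‖ := by
  have h0 : (0:ℂ) ∈ ball (0:ℂ) 1 := by simp
  have hnh : ∀ z ∈ ball (0:ℂ) 1, ball (0:ℂ) 1 ∈ nhds z := fun z hz => isOpen_ball.mem_nhds hz
  have hne : ∀ z ∈ ball (0:ℂ) 1, w - f z ≠ 0 := by
    intro z hz h
    exact hw ⟨z, hz, (sub_eq_zero.1 h).symm⟩
  set g : ℂ → ℂ := fun z => (w - f z)⁻¹ with hg
  have hfd : ∀ z ∈ ball (0:ℂ) 1, HasDerivAt f (deriv f z) z := fun z hz =>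
    (hf.differentiableAt (hnh z hz)).hasDerivAt
  have hgd : ∀ z ∈ ball (0:ℂ) 1, HasDerivAt g (deriv f z / (w - f z) ^ 2) z := by
    intro z hz
    have := ((hfd z hz).const_sub w).inv (hne z hz)
    convert! this using 1
    ring
  have hginj : InjOn g (ball 0 1) := by
    intro x hx y hy hxy
    apply hinj hx hy
    have := inv_injective hxy
    exact sub_right_injective this
  have hg1 := (hgd 0 h0).deriv
  have hW := hne 0 h0
  have hg2 : deriv (deriv g) 0 = deriv (deriv f) 0 / (w - f 0) ^ 2 +
      2 * (deriv f 0) ^ 2 / (w - f 0) ^ 3 := by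
    have he : deriv g =ᶠ[nhds 0] fun z => deriv f z / (w - f z) ^ 2 := by
      filter_upwards [hnh 0 h0] with z hz using (hgd z hz).deriv
    rw [he.deriv_eq]
    have h1 := ((hf.deriv isOpen_ball).differentiableAt (hnh 0 h0)).hasDerivAt
    have h2 : HasDerivAt (fun z => (w - f z) ^ 2) (2 * (w - f 0) * (-deriv f 0)) 0 := by
      have h5 := ((hfd 0 h0).const_sub w).pow 2
      convert! h5 using 1
      simp
    have h3 := h1.div h2 (pow_ne_zero 2 hW)
    have h4 : HasDerivAt (fun z => deriv f z / (w - f z) ^ 2) _ 0 := h3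
    rw [h4.deriv]
    field_simp
    ring
  have hB1 := aux_bieberbach f hf hinj hf'
  have hB2 := aux_bieberbach g (fun z hz => (hgd z hz).differentiableAt.differentiableWithinAt)
    hginj (by rw [hg1]; exact div_ne_zero hf' (pow_ne_zero 2 hW))
  rw [hg1, hg2] at hB2
  set W := w - f 0
  set a := deriv f 0
  set c := deriv (deriv f) 0
  have hWp : 0 < ‖W‖ := norm_pos_iff.2 hW
  have hap : 0 < ‖a‖ := norm_pos_iff.2 hf'
  have e1 : c / W ^ 2 + 2 * a ^ 2 / W ^ 3 = (c * W + 2 * a ^ 2) / W ^ 3 := by field_simp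
  rw [e1, norm_div, norm_div, norm_pow, norm_pow, ← mul_div_assoc,
    div_le_div_iff₀ (by positivity) (by positivity)] at hB2
  have e2 : ‖c * W + 2 * a ^ 2‖ ≤ 4 * ‖a‖ * ‖W‖ := by
    have : ‖c * W + 2 * a ^ 2‖ * ‖W‖ ^ 2 ≤ (4 * ‖a‖ * ‖W‖) * ‖W‖ ^ 2 := by
      refine hB2.trans (le_of_eq (by ring))
    exact le_of_mul_le_mul_right this (by positivity)
  have e3 : ‖2 * a ^ 2‖ ≤ ‖c * W + 2 * a ^ 2‖ + ‖c * W‖ := by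
    have := norm_sub_le (c * W + 2 * a ^ 2) (c * W)
    simpa using this
  rw [norm_mul, norm_pow, Complex.norm_ofNat, norm_mul] at e3
  have e4 : ‖c‖ * ‖W‖ ≤ 4 * ‖a‖ * ‖W‖ := mul_le_mul_of_nonneg_right hB1 hWp.le
  have e5 : ‖a‖ * ‖a‖ ≤ ‖a‖ * (4 * ‖W‖) := by nlinarith
  exact le_of_mul_le_mul_left e5 hap



lemma aux_xi (f : ℂ → ℂ) (φ : ℂ → ℝ)
    (hf : DifferentiableOn ℂ f (ball (0:ℂ) 1))
    (hinj : InjOn f (ball (0:ℂ) 1)) (hf' : ∀ z ∈ ball (0:ℂ) 1, deriv f z ≠ 0)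
    (hφ : ∀ ζ ∈ ball (0:ℂ) 1,
      Real.exp (φ (f ζ)) = 4 / ((1 - ‖ζ‖ ^ 2) ^ 2 * ‖deriv f ζ‖ ^ 2)) :
    (epsteinMap φ (f 0)).2 =
        ‖deriv f 0‖ / (1 + ‖deriv (deriv f) 0 / (2 * deriv f 0)‖ ^ 2) := by
  have h0 : (0:ℂ) ∈ ball (0:ℂ) 1 := by simp
  have hnh : ∀ z ∈ ball (0:ℂ) 1, ball (0:ℂ) 1 ∈ nhds z := fun z hz => isOpen_ball.mem_nhds hz
  set a := deriv f 0 with ha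
  set c := deriv (deriv f) 0 with hc
  have ha0 : a ≠ 0 := hf' 0 h0
  have hap : 0 < ‖a‖ := norm_pos_iff.2 ha0
  set g := Function.invFunOn f (ball 0 1) with hg
  have hg0 : g (f 0) = 0 := hinj (Function.invFunOn_mem ⟨0, h0, rfl⟩) h0
    (Function.invFunOn_eq ⟨0, h0, rfl⟩)
  have hgd := aux_inv f hf hinj 0 h0 ha0
  rw [← hg, ← ha] at hgd
  -- the log-density in the disc
  set Φ : ℂ → ℝ := fun ζ => Real.log 4 - 2 * Real.log (1 - ‖ζ‖ ^ 2) -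
    2 * (Complex.log (deriv f ζ / a)).re - 2 * Real.log ‖a‖ with hΦ
  have hΦf : ∀ ζ ∈ ball (0:ℂ) 1, φ (f ζ) = Φ ζ := by
    intro ζ hζ
    have h1 : 0 < 1 - ‖ζ‖ ^ 2 := by
      have : ‖ζ‖ < 1 := by simpa using hζ
      nlinarith [norm_nonneg ζ]
    have h2 : 0 < ‖deriv f ζ‖ := norm_pos_iff.2 (hf' ζ hζ)
    have := congrArg Real.log (hφ ζ hζ)
    rw [Real.log_exp, Real.log_div (by norm_num) (by positivity),
      Real.log_mul (by positivity) (by positivity), Real.log_pow, Real.log_pow] at this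
    rw [this]
    simp only [hΦ]
    rw [Complex.log_re, norm_div, Real.log_div h2.ne' hap.ne']
    push_cast; ring
  have hφg : φ =ᶠ[nhds (f 0)] fun y => Φ (g y) := by
    have hop : f '' ball 0 1 ∈ nhds (f 0) := by
      have hs : HasStrictDerivAt f a 0 := (hf.analyticAt (hnh 0 h0)).hasStrictDerivAt
      rw [← hs.map_nhds_eq ha0]
      exact Filter.image_mem_map (hnh 0 h0)
    filter_upwards [hop] with y hy
    have := hΦf (g y) (Function.invFunOn_mem hy)
    rwa [Function.invFunOn_eq hy] at this
  have hn : HasFDerivAt (fun ζ : ℂ => Real.log (1 - ‖ζ‖ ^ 2)) (0 : ℂ →L[ℝ] ℝ) 0 := by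
    have h1 : HasFDerivAt (fun ζ : ℂ => ‖ζ‖ ^ 2) (0 : ℂ →L[ℝ] ℝ) 0 := by
      have := (hasStrictFDerivAt_norm_sq (0:ℂ)).hasFDerivAt
      simpa using this
    have h2 := (h1.const_sub 1).log (by simp)
    simpa using h2
  have hl : HasDerivAt (fun ζ => Complex.log (deriv f ζ / a)) (c / a) 0 := by
    have h1 := ((hf.deriv isOpen_ball).differentiableAt (hnh 0 h0)).hasDerivAt
    have h2 := (h1.div_const a).clog (by rw [← ha, div_self ha0]; simp)
    rw [← ha, div_self ha0, div_one] at h2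
    exact h2
  have hlr : HasFDerivAt (fun ζ => (Complex.log (deriv f ζ / a)).re)
      (Complex.reCLM.comp ((ContinuousLinearMap.toSpanSingleton ℂ (c / a)).restrictScalars ℝ)) 0 :=
    Complex.reCLM.hasFDerivAt.comp 0 (hl.hasFDerivAt.restrictScalars ℝ)
  have hΦd := (((hn.const_mul 2).const_sub (Real.log 4)).sub (hlr.const_mul 2)).sub_const
    (2 * Real.log ‖a‖)
  have hgR := hgd.hasFDerivAt.restrictScalars ℝ
  rw [← hg0] at hΦd
  have hcomp := (hΦd.comp (f 0) hgR).congr_of_eventuallyEq hφg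
  have hfd := hcomp.fderiv
  have hw : wirtingerBar φ (f 0) = - starRingEnd ℂ (c / a ^ 2) := by
    unfold wirtingerBar
    rw [hfd]
    have e : c / a ^ 2 = a⁻¹ * (c / a) := by field_simp
    rw [e]
    generalize c / a = x
    generalize a⁻¹ = y
    apply Complex.ext
    · simp; ring
    · simp; ring
  have hexp : Real.exp (-(φ (f 0)) / 2) = ‖a‖ / 2 := by
    have h1 := hφ 0 h0
    rw [← ha] at h1
    simp only [norm_zero, ne_eq, OfNat.ofNat_ne_zero, not_false_eq_true, zero_pow, sub_zero,
      one_pow, one_mul] at h1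
    have h2 : Real.exp (-(φ (f 0)) / 2) ^ 2 = (‖a‖ / 2) ^ 2 := by
      rw [← Real.exp_nat_mul]
      have : ((2:ℕ):ℝ) * (-(φ (f 0)) / 2) = -(φ (f 0)) := by push_cast; ring
      rw [this, Real.exp_neg, h1]
      field_simp; norm_num
    exact (pow_left_inj₀ (Real.exp_pos _).le (by positivity) two_ne_zero).1 h2
  have hpsi : ‖epsteinPsi φ (f 0)‖ = ‖c / (2 * a)‖ := by
    unfold epsteinPsi
    rw [hw, hexp, norm_mul, norm_neg, Complex.norm_conj, Complex.norm_real, Real.norm_eq_abs,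
      abs_of_pos (by positivity), norm_div, norm_div, norm_pow, norm_mul, Complex.norm_ofNat]
    field_simp
  simp only [epsteinMap, epsteinXi]
  rw [hpsi, hexp]
  congr 1
  ring

end aux

/-- The height coordinate of the Epstein–Poincaré map at `z₀ = f 0` equals
`|f'(0)|/(1+|f''(0)/(2f'(0))|²)` and is comparable to the distance to the boundary:
`d(z₀,γ)/5 ≤ ξ(z₀) ≤ 4 d(z₀,γ)`.  Here `φ` is the log-density of the hyperbolic metric
of the Jordan domain `Ω = f(𝔻)`. -/
theorem epstein_height_at_center
    (Ω γ : Set ℂ) (f : ℂ → ℂ) (φ : ℂ → ℝ) (z₀ : ℂ)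
    (hγ : IsJordanCurve γ) (hfr : frontier Ω = γ) (hΩ : IsOpen Ω)
    (hf : DifferentiableOn ℂ f (ball (0:ℂ) 1))
    (hinj : InjOn f (ball (0:ℂ) 1))
    (him : f '' ball (0:ℂ) 1 = Ω) (hf0 : f 0 = z₀)
    (hφ : ∀ ζ ∈ ball (0:ℂ) 1,
      Real.exp (φ (f ζ)) = 4 / ((1 - ‖ζ‖ ^ 2) ^ 2 * ‖deriv f ζ‖ ^ 2)) :
    (epsteinMap φ z₀).2 =
        ‖deriv f 0‖ / (1 + ‖deriv (deriv f) 0 / (2 * deriv f 0)‖ ^ 2) ∧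
      infDist z₀ γ / 5 ≤ (epsteinMap φ z₀).2 ∧
      (epsteinMap φ z₀).2 ≤ 4 * infDist z₀ γ := by
  have h0 : (0:ℂ) ∈ ball (0:ℂ) 1 := by simp
  have hf' : ∀ z ∈ ball (0:ℂ) 1, deriv f z ≠ 0 := by
    intro z hz h
    have h1 := hφ z hz
    rw [h] at h1
    simp at h1
  subst hf0
  have hxi := aux_xi f φ hf hinj hf' hφ
  have hγne : γ.Nonempty := by
    obtain ⟨c, -, -, hc⟩ := hγ
    exact ⟨c 0, hc ▸ mem_range_self 0⟩
  have hz0 : f 0 ∈ Ω := him ▸ mem_image_of_mem f h0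
  have hdisj : Disjoint γ Ω := by rw [← hfr]; exact disjoint_frontier_iff_isOpen.2 hΩ
  have hγc : IsClosed γ := by rw [← hfr]; exact isClosed_frontier
  obtain ⟨w, hwγ, hwd⟩ := hγc.exists_infDist_eq_dist hγne (f 0)
  have hwΩ : w ∉ Ω := fun h => Set.disjoint_left.1 hdisj hwγ h
  have hd0 : 0 < infDist (f 0) γ :=
    (hγc.notMem_iff_infDist_pos hγne).1 (fun h => Set.disjoint_left.1 hdisj h hz0)
  have hΩu : Ω ≠ univ := fun h => hwΩ (h ▸ mem_univ w)
  have hsub : ball (f 0) (infDist (f 0) γ) ⊆ f '' ball 0 1 := by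
    rw [him]
    obtain ⟨y, hy, hyd⟩ := exists_mem_frontier_infDist_compl_eq_dist hz0 hΩu
    have hle : infDist (f 0) γ ≤ infDist (f 0) Ωᶜ := by
      rw [hyd]; exact infDist_le_dist_of_mem (hfr ▸ hy)
    intro x hx
    by_contra hxΩ
    have := infDist_le_dist_of_mem (x := f 0) (show x ∈ Ωᶜ from hxΩ)
    rw [mem_ball, dist_comm] at hx
    linarith
  have hlow := aux_dist_le f hf hinj hf' _ hd0 hsub
  have hup := aux_koebe f hf hinj (hf' 0 h0) w (by rw [him]; exact hwΩ)
  have hB := aux_bieberbach f hf hinj (hf' 0 h0)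
  have hap : 0 < ‖deriv f 0‖ := norm_pos_iff.2 (hf' 0 h0)
  rw [dist_comm, dist_eq_norm] at hwd
  rw [← hwd] at hup
  refine ⟨hxi, ?_, ?_⟩
  · rw [hxi]
    have h2 : ‖deriv (deriv f) 0 / (2 * deriv f 0)‖ ≤ 2 := by
      rw [norm_div, norm_mul, Complex.norm_ofNat, div_le_iff₀ (by positivity)]
      linarith
    have h3 : ‖deriv (deriv f) 0 / (2 * deriv f 0)‖ ^ 2 ≤ 2 ^ 2 :=
      pow_le_pow_left₀ (norm_nonneg _) h2 2
    apply div_le_div₀ hap.le hlow (by positivity)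
    linarith
  · rw [hxi]
    refine le_trans (div_le_self hap.le ?_) hup
    have := sq_nonneg ‖deriv (deriv f) 0 / (2 * deriv f 0)‖
    linarith
end

section
/- Let Ω be a simply connected domain bounded by a Jordan curve γ ⊂ ℂ, and let Ep_Ω : Ω → ℍ³ be the Epstein–Poincaré map into the upper half-space model. Then Ep_Ω extends continuously to the identity map on γ, and for all z ∈ Ω, (√5 − 2)·d(z,γ) ≤ d(Ep_Ω(z), γ) ≤ 5·d(z,γ), where d denotes Euclidean distance in ℝ³ (identifying ℂ with ℂ × {0} ⊂ ∂ℍ³). -/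
open Complex Metric Set

/-- The embedding of the upper half-space model `ℂ × ℝ` into `ℝ³` with the Euclidean
(`L²`-product) metric. -/
noncomputable def toEuc (p : ℂ × ℝ) : WithLp 2 (ℂ × ℝ) := (WithLp.equiv 2 (ℂ × ℝ)).symm p


def Ann (a b : ℝ) : Set ℂ := {z | a < ‖z‖ ∧ ‖z‖ < b}

lemma isOpen_Ann (a b : ℝ) : IsOpen (Ann a b) :=
  (isOpen_lt continuous_const continuous_norm).inter (isOpen_lt continuous_norm continuous_const)

lemma polar_eq_circleMap (p : ℝ × ℝ) : Complex.polarCoord.symm p = circleMap 0 p.1 p.2 := by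
  rw [Complex.polarCoord_symm_apply, circleMap, Complex.exp_mul_I]
  push_cast; ring

lemma ann_integrable {q : ℂ → ℂ} {M a b : ℝ} (hq : DifferentiableOn ℂ q (ball 0 M))
    (ha : 0 < a) (hbM : b < M) :
    MeasureTheory.IntegrableOn (fun z => (q z).re / ‖z‖ ^ 2) (Ann a b) := by
  have hc : IsCompact {z : ℂ | a ≤ ‖z‖ ∧ ‖z‖ ≤ b} := by
    refine (isCompact_closedBall (0:ℂ) b).of_isClosed_subset ?_ ?_
    · exact (isClosed_le continuous_const continuous_norm).inter
        (isClosed_le continuous_norm continuous_const)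
    · intro z hz; simpa using hz.2
  have : ContinuousOn (fun z => (q z).re / ‖z‖ ^ 2) {z : ℂ | a ≤ ‖z‖ ∧ ‖z‖ ≤ b} := by
    apply ContinuousOn.div
    · apply Complex.continuous_re.comp_continuousOn
      exact hq.continuousOn.mono fun z hz => by simpa using hz.2.trans_lt hbM
    · fun_prop
    · intro z hz; have := ha.trans_le hz.1; positivity
  exact (this.integrableOn_compact hc).mono_set fun z hz => ⟨hz.1.le, hz.2.le⟩

lemma circle_mean {q : ℂ → ℂ} {M r : ℝ} (hq : DifferentiableOn ℂ q (ball 0 M))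
    (h0 : 0 < r) (hbM : r < M) :
    ∫ θ in Ioo (-Real.pi) Real.pi, (q (circleMap 0 r θ)).re = 2 * Real.pi * (q 0).re := by
  have h1 : Real.circleAverage q 0 r = q 0 := by
    apply DiffContOnCl.circleAverage
    rw [abs_of_pos h0]
    apply DifferentiableOn.diffContOnCl
    rw [closure_ball _ h0.ne']
    exact hq.mono (closedBall_subset_ball hbM)
  have hcont : Continuous fun θ => q (circleMap 0 r θ) := by
    apply hq.continuousOn.comp_continuous (continuous_circleMap 0 r)
    intro θ; simpa [abs_of_pos h0] using hbM
  have h2 : ∫ θ in (0:ℝ)..2 * Real.pi, q (circleMap 0 r θ) = 2 * Real.pi * q 0 := by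
    rw [Real.circleAverage] at h1
    have hpi : (Real.pi : ℂ) ≠ 0 := by exact_mod_cast Real.pi_ne_zero
    rw [← h1, Complex.real_smul]; push_cast; field_simp
  have h3 : ∫ θ in (-Real.pi)..Real.pi, q (circleMap 0 r θ) = 2 * Real.pi * q 0 := by
    have hp : Function.Periodic (fun θ => q (circleMap 0 r θ)) (2 * Real.pi) := by
      intro θ; simp [periodic_circleMap 0 r θ]
    rw [← h2]
    have := hp.intervalIntegral_add_eq (-Real.pi) 0
    rw [zero_add] at this
    rw [← this]; congr 1; ring
  rw [← MeasureTheory.integral_Ioc_eq_integral_Ioo,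
    ← intervalIntegral.integral_of_le (by linarith [Real.pi_pos])]
  have h4 := congrArg Complex.re h3
  have h5 : (∫ θ in (-Real.pi)..Real.pi, q (circleMap 0 r θ)).re =
    ∫ θ in (-Real.pi)..Real.pi, (q (circleMap 0 r θ)).re := by
    have := Complex.reCLM.intervalIntegral_comp_comm (hcont.intervalIntegrable (μ := MeasureTheory.volume) (-Real.pi) Real.pi)
    simpa using this.symm
  rw [← h5, h4]
  rw [show (2 * Real.pi * q 0 : ℂ) = ((2 * Real.pi : ℝ) : ℂ) * q 0 by push_cast; ring, Complex.re_ofReal_mul]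

lemma ann_integral {q : ℂ → ℂ} {M a b : ℝ} (hq : DifferentiableOn ℂ q (ball 0 M))
    (ha : 0 < a) (hab : a < b) (hbM : b < M) :
    ∫ z in Ann a b, (q z).re / ‖z‖ ^ 2 = 2 * Real.pi * (q 0).re * Real.log (b / a) := by
  rw [← MeasureTheory.integral_indicator (isOpen_Ann a b).measurableSet,
    ← Complex.integral_comp_polarCoord_symm]
  change (∫ p in Ioi (0:ℝ) ×ˢ Ioo (-Real.pi) Real.pi, _) = _
  have e1 : ∫ p in Ioi (0:ℝ) ×ˢ Ioo (-Real.pi) Real.pi,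
      p.1 • (Ann a b).indicator (fun z => (q z).re / ‖z‖ ^ 2) (Complex.polarCoord.symm p) =
      ∫ p in Ioo a b ×ˢ Ioo (-Real.pi) Real.pi, p.1⁻¹ * (q (circleMap 0 p.1 p.2)).re := by
    rw [← MeasureTheory.integral_indicator (measurableSet_Ioi.prod measurableSet_Ioo),
      ← MeasureTheory.integral_indicator (measurableSet_Ioo.prod measurableSet_Ioo)]
    congr 1
    ext p
    simp only [polar_eq_circleMap]
    by_cases hp : p ∈ Ioo a b ×ˢ Ioo (-Real.pi) Real.pi
    · have h0 : 0 < p.1 := ha.trans hp.1.1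
      rw [indicator_of_mem hp, indicator_of_mem (show p ∈ Ioi (0:ℝ) ×ˢ Ioo (-Real.pi) Real.pi from ⟨h0, hp.2⟩), indicator_of_mem]
      · simp [abs_of_pos h0]; field_simp
      · simp only [Ann, mem_ofPred_eq, norm_circleMap_zero, abs_of_pos h0]; exact hp.1
    · rw [indicator_of_notMem hp]
      by_cases hp' : p ∈ Ioi (0:ℝ) ×ˢ Ioo (-Real.pi) Real.pi
      · rw [indicator_of_mem hp', indicator_of_notMem, smul_zero]
        intro h
        have h0 : 0 < p.1 := hp'.1
        simp only [Ann, mem_ofPred_eq, norm_circleMap_zero, abs_of_pos h0] at h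
        exact hp ⟨h, hp'.2⟩
      · rw [indicator_of_notMem hp']
  rw [e1, MeasureTheory.Measure.volume_eq_prod, MeasureTheory.setIntegral_prod]
  · have : ∀ r ∈ Ioo a b, ∫ θ in Ioo (-Real.pi) Real.pi, r⁻¹ * (q (circleMap 0 r θ)).re =
        (2 * Real.pi * (q 0).re) * r⁻¹ := by
      intro r hr
      rw [MeasureTheory.integral_const_mul, circle_mean hq (ha.trans hr.1) (hr.2.trans hbM)]
      ring
    rw [MeasureTheory.setIntegral_congr_fun measurableSet_Ioo this,
      MeasureTheory.integral_const_mul, ← MeasureTheory.integral_Ioc_eq_integral_Ioo,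
      ← intervalIntegral.integral_of_le hab.le, integral_inv_of_pos ha (ha.trans hab)]
  · rw [← MeasureTheory.Measure.volume_eq_prod]
    have hK : IsCompact (Icc a b ×ˢ Icc (-Real.pi) Real.pi) := isCompact_Icc.prod isCompact_Icc
    have : ContinuousOn (fun p : ℝ × ℝ => p.1⁻¹ * (q (circleMap 0 p.1 p.2)).re)
        (Icc a b ×ˢ Icc (-Real.pi) Real.pi) := by
      apply ContinuousOn.mul
      · apply ContinuousOn.inv₀ (by fun_prop)
        intro p hp; exact (ha.trans_le hp.1.1).ne'
      · apply Complex.continuous_re.comp_continuousOn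
        apply hq.continuousOn.comp
        · unfold circleMap; fun_prop
        · intro p hp
          simp [abs_of_pos (ha.trans_le hp.1.1)]
          exact hp.1.2.trans_lt hbM
    exact (this.integrableOn_compact hK).mono_set
      (prod_mono Ioo_subset_Icc_self Ioo_subset_Icc_self)

lemma det_cmul (c : ℂ) : ((ContinuousLinearMap.toSpanSingleton ℂ c).restrictScalars ℝ : ℂ →L[ℝ] ℂ).det = ‖c‖ ^ 2 := by
  have h := LinearMap.det_restrictScalars (R := ℝ) (S := ℂ) (f := (ContinuousLinearMap.toSpanSingleton ℂ c : ℂ →ₗ[ℂ] ℂ))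
  have h2 : (ContinuousLinearMap.toSpanSingleton ℂ c : ℂ →ₗ[ℂ] ℂ).det = c := by
    have := ContinuousLinearMap.det_toSpanSingleton c
    exact this
  rw [h2, Algebra.norm_complex_apply, Complex.normSq_eq_norm_sq] at h
  exact h

open MeasureTheory in
lemma ofReal_integral_le {α : Type*} [MeasurableSpace α] (μ : Measure α) (f : α → ℝ)
    (h : Integrable f μ) :
    ENNReal.ofReal (∫ x, f x ∂μ) ≤ ∫⁻ x, ENNReal.ofReal (f x) ∂μ := by
  rw [integral_eq_lintegral_pos_part_sub_lintegral_neg_part h]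
  refine (ENNReal.ofReal_le_ofReal (sub_le_self _ ENNReal.toReal_nonneg)).trans ?_
  exact ENNReal.ofReal_toReal_le


open MeasureTheory in
lemma area_image {u u' : ℂ → ℂ} {A : Set ℂ} (hA : IsOpen A)
    (hu : ∀ z ∈ A, HasDerivAt u (u' z) z) (hinj : InjOn u A) :
    MeasurableSet (u '' A) ∧ ∫⁻ w in u '' A, ENNReal.ofReal (1 / ‖w‖ ^ 2) =
      ∫⁻ z in A, ENNReal.ofReal (‖u' z‖ ^ 2 / ‖u z‖ ^ 2) := by
  have h : ∀ z ∈ A, HasFDerivWithinAt u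
      ((ContinuousLinearMap.toSpanSingleton ℂ (u' z)).restrictScalars ℝ : ℂ →L[ℝ] ℂ) A z := by
    intro z hz
    exact ((hu z hz).hasFDerivAt.restrictScalars ℝ).hasFDerivWithinAt
  refine ⟨measurable_image_of_fderivWithin hA.measurableSet h hinj, ?_⟩
  rw [lintegral_image_eq_lintegral_abs_det_fderiv_mul volume hA.measurableSet h hinj]
  congr 1
  ext z
  rw [det_cmul, ← ENNReal.ofReal_mul (abs_nonneg _), abs_of_nonneg (by positivity)]
  congr 1; ring

lemma area_lower {t : ℂ → ℂ} (ht : DifferentiableOn ℂ t (ball 0 1)) (h0 : t 0 = 0)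
    (hne : ∀ z ∈ ball (0:ℂ) 1, z ≠ 0 → t z ≠ 0) (hd : deriv t 0 ≠ 0) {ε R : ℝ} (hε : 0 < ε)
    (hεR : ε < R) (hR : R < 1) :
    ENNReal.ofReal (2 * Real.pi * Real.log (R / ε)) ≤
      ∫⁻ z in Ann ε R, ENNReal.ofReal (‖deriv t z‖ ^ 2 / ‖t z‖ ^ 2) := by
  set k := dslope t 0 with hk
  have hkd : DifferentiableOn ℂ k (ball 0 1) :=
    (Complex.differentiableOn_dslope (ball_mem_nhds _ one_pos)).2 ht
  have hkz : ∀ z, t z = z * k z := by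
    intro z
    have := sub_smul_dslope t 0 z
    rw [h0] at this; simp at this; rw [hk, this]
  have hkne : ∀ z ∈ ball (0:ℂ) 1, k z ≠ 0 := by
    intro z hz
    by_cases h : z = 0
    · rw [h, hk, dslope_same]; exact hd
    · intro h'; apply hne z hz h; rw [hkz, h', mul_zero]
  have hkd' : DifferentiableOn ℂ (deriv k) (ball 0 1) := hkd.deriv isOpen_ball
  set q : ℂ → ℂ := fun z => 1 + 2 * (z * deriv k z / k z) with hq
  have hqd : DifferentiableOn ℂ q (ball 0 1) := by
    apply DifferentiableOn.add (by fun_prop)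
    apply DifferentiableOn.mul (by fun_prop)
    exact (differentiableOn_id.mul hkd').div hkd hkne
  have hI := ann_integral hqd hε hεR hR
  have hq0 : (q 0).re = 1 := by simp [hq]
  rw [hq0, mul_one] at hI
  rw [← hI]
  refine (ofReal_integral_le _ _ (ann_integrable hqd hε hR)).trans ?_
  apply MeasureTheory.setLIntegral_mono' (isOpen_Ann ε R).measurableSet
  intro z hz
  apply ENNReal.ofReal_le_ofReal
  have hz1 : z ∈ ball (0:ℂ) 1 := by simpa using hz.2.trans hR
  have hz0 : z ≠ 0 := norm_pos_iff.1 (hε.trans hz.1)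
  have hder : deriv t z = k z + z * deriv k z := by
    have h1 : HasDerivAt k (deriv k z) z :=
      (hkd.differentiableAt (isOpen_ball.mem_nhds hz1)).hasDerivAt
    have h2 := (hasDerivAt_id z).mul h1
    have h3 : t = id * k := by ext w; simpa using hkz w
    rw [h3, h2.deriv]; simp
  have hk0 := hkne z hz1
  set x : ℂ := 1 + z * deriv k z / k z with hx
  have e1 : ‖deriv t z‖ ^ 2 / ‖t z‖ ^ 2 = ‖x‖ ^ 2 / ‖z‖ ^ 2 := by
    rw [← div_pow, ← div_pow, ← norm_div, ← norm_div, hder, hkz z, hx]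
    congr 2; field_simp
  rw [e1]
  gcongr
  have : q z = 2 * x - 1 := by rw [hq, hx]; ring
  rw [this, ← Complex.normSq_eq_norm_sq, Complex.normSq_apply]
  simp
  nlinarith [sq_nonneg (x.re - 1), sq_nonneg x.im]

lemma covers {t : ℂ → ℂ} (ht : DifferentiableOn ℂ t (ball 0 1)) (h0 : t 0 = 0)
    {κ : ℝ} (hκ : κ < ‖deriv t 0‖) (hκ0 : 0 < κ) :
    ∃ ε₀ > 0, ∀ ε, 0 < ε → ε < ε₀ → closedBall 0 (κ * ε) ⊆ t '' closedBall 0 ε := by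
  have hs : HasStrictDerivAt t (deriv t 0) 0 :=
    (ht.analyticAt (ball_mem_nhds _ one_pos)).hasStrictDerivAt
  have hd : deriv t 0 ≠ 0 := norm_pos_iff.1 (hκ0.trans hκ)
  have hs' := hs.hasStrictFDerivAt
  let c : NNReal := ⟨‖deriv t 0‖ - κ, by linarith⟩
  have hc : 0 < c := by rw [← NNReal.coe_pos]; exact sub_pos.2 hκ
  obtain ⟨s, hs0, hs1⟩ := hs'.approximates_deriv_on_nhds (Or.inr hc)
  obtain ⟨ε₀, hε₀, hb⟩ := Metric.mem_nhds_iff.1 hs0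
  refine ⟨ε₀, hε₀, fun ε hε hεε => ?_⟩
  let N : (ContinuousLinearMap.toSpanSingleton ℂ (deriv t 0)).NonlinearRightInverse :=
    { toFun := fun y => y / deriv t 0
      nnnorm := ‖deriv t 0‖₊⁻¹
      bound' := by intro y; simp [div_eq_inv_mul]
      right_inv' := by intro y; simp [hd] }
  have := hs1.surjOn_closedBall_of_nonlinearRightInverse N hε.le
    ((closedBall_subset_ball hεε).trans hb)
  rw [h0] at this
  have e : ((N.nnnorm : ℝ)⁻¹ - (c : ℝ)) = κ := by
    have e1 : (N.nnnorm : ℝ)⁻¹ = ‖deriv t 0‖ := by simp [N]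
    have e2 : (c : ℝ) = ‖deriv t 0‖ - κ := rfl
    rw [e1, e2]; ring
  rw [e] at this
  exact this

open MeasureTheory in
/-- Univalent Bieberbach–Eilenberg functions. -/
lemma bieb_eil {t : ℂ → ℂ} (ht : DifferentiableOn ℂ t (ball 0 1)) (h0 : t 0 = 0)
    (hinj : InjOn t (ball 0 1))
    (hBE : ∀ z ∈ ball (0:ℂ) 1, ∀ w ∈ ball (0:ℂ) 1, t z * t w ≠ 1) : ‖deriv t 0‖ ≤ 1 := by
  by_contra! hlt
  have hmem0 : (0:ℂ) ∈ ball (0:ℂ) 1 := by simp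
  have hne : ∀ z ∈ ball (0:ℂ) 1, z ≠ 0 → t z ≠ 0 := by
    intro z hz hz0 h
    exact hz0 (hinj hz hmem0 (h.trans h0.symm))
  have hd : deriv t 0 ≠ 0 := norm_pos_iff.1 (one_pos.trans hlt)
  obtain ⟨κ, hκ1, hκ2⟩ := exists_between hlt
  have hκ0 : 0 < κ := one_pos.trans hκ1
  obtain ⟨ε₀, hε₀, hcov⟩ := covers ht h0 hκ2 hκ0
  obtain ⟨R, hR1, hR2⟩ := exists_between (show κ⁻¹ < 1 from inv_lt_one_of_one_lt₀ hκ1)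
  have hR0 : 0 < R := (inv_pos.2 hκ0).trans hR1
  obtain ⟨ε, hε, hεm⟩ := exists_between (show 0 < min ε₀ κ⁻¹ from lt_min hε₀ (inv_pos.2 hκ0))
  have hε1 : ε < κ⁻¹ := hεm.trans_le (min_le_right _ _)
  have hεR : ε < R := hε1.trans hR1
  have hc := hcov ε hε (hεm.trans_le (min_le_left _ _))
  set δ := κ * ε with hδ
  have hδ0 : 0 < δ := by positivity
  have hδ1 : δ < 1 := by
    calc δ < κ * κ⁻¹ := by rw [hδ]; gcongr
      _ = 1 := mul_inv_cancel₀ hκ0.ne'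
  have hε11 : ε < 1 := hεR.trans hR2
  have hsub : closedBall (0:ℂ) ε ⊆ ball 0 1 := closedBall_subset_ball hε11
  have hA1 : ∀ z ∈ Ann ε R, z ∈ ball (0:ℂ) 1 := fun z hz => by simpa using hz.2.trans hR2
  have hA0 : ∀ z ∈ Ann ε R, t z ≠ 0 := fun z hz => hne z (hA1 z hz) (norm_pos_iff.1 (hε.trans hz.1))
  have hlo : ∀ z ∈ Ann ε R, δ < ‖t z‖ := by
    intro z hz
    by_contra! h
    obtain ⟨w, hw, hwt⟩ := hc (show t z ∈ closedBall 0 δ by simpa using h)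
    have := hinj (hsub hw) (hA1 z hz) hwt
    rw [this] at hw
    have h1 := hz.1
    simp at hw; linarith
  have hhi : ∀ z ∈ Ann ε R, ‖t z‖ < δ⁻¹ := by
    intro z hz
    by_contra! h
    have h' : ‖(t z)⁻¹‖ ≤ δ := by
      rw [norm_inv]; exact inv_le_of_inv_le₀ hδ0 h
    obtain ⟨w, hw, hwt⟩ := hc (show (t z)⁻¹ ∈ closedBall 0 δ by simpa using h')
    apply hBE z (hA1 z hz) w (hsub hw)
    rw [hwt, mul_inv_cancel₀ (hA0 z hz)]
  have hder : ∀ z ∈ Ann ε R, HasDerivAt t (deriv t z) z := fun z hz =>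
    (ht.differentiableAt (isOpen_ball.mem_nhds (hA1 z hz))).hasDerivAt
  have hderi : ∀ z ∈ Ann ε R, HasDerivAt (t⁻¹) (-deriv t z / t z ^ 2) z := fun z hz =>
    (hder z hz).inv (hA0 z hz)
  have hinjA : InjOn t (Ann ε R) := hinj.mono hA1
  have hinjA' : InjOn t⁻¹ (Ann ε R) := fun z hz w hw h => hinjA hz hw (inv_injective h)
  obtain ⟨-, a1⟩ := area_image (isOpen_Ann ε R) hder hinjA
  obtain ⟨m2, a2⟩ := area_image (isOpen_Ann ε R) hderi hinjA'
  have a3 : ∫⁻ z in Ann ε R, ENNReal.ofReal (‖-deriv t z / t z ^ 2‖ ^ 2 / ‖t⁻¹ z‖ ^ 2) =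
      ∫⁻ z in Ann ε R, ENNReal.ofReal (‖deriv t z‖ ^ 2 / ‖t z‖ ^ 2) := by
    apply setLIntegral_congr_fun (isOpen_Ann ε R).measurableSet
    intro z hz
    have := norm_pos_iff.2 (hA0 z hz)
    simp only [Pi.inv_apply, norm_div, norm_neg, norm_pow, norm_inv]
    congr 1; field_simp
  rw [a3] at a2
  have hdisj : Disjoint (t '' Ann ε R) (t⁻¹ '' Ann ε R) := by
    rw [Set.disjoint_left]
    rintro _ ⟨z, hz, rfl⟩ ⟨w, hw, h⟩
    apply hBE z (hA1 z hz) w (hA1 w hw)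
    rw [← h, Pi.inv_apply, inv_mul_cancel₀ (hA0 w hw)]
  have hsubA : t '' Ann ε R ∪ t⁻¹ '' Ann ε R ⊆ Ann δ δ⁻¹ := by
    rintro _ (⟨z, hz, rfl⟩ | ⟨z, hz, rfl⟩)
    · exact ⟨hlo z hz, hhi z hz⟩
    · have h1 := hlo z hz
      have h2 := hhi z hz
      refine ⟨?_, ?_⟩
      · rw [Pi.inv_apply, norm_inv]
        exact lt_inv_of_lt_inv₀ (hδ0.trans h1) h2
      · rw [Pi.inv_apply, norm_inv]
        exact inv_strictAnti₀ hδ0 h1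
  have hδi : δ < δ⁻¹ := hδ1.trans ((one_lt_inv₀ hδ0).2 hδ1)
  have hup : ∫⁻ w in Ann δ δ⁻¹, ENNReal.ofReal (1 / ‖w‖ ^ 2) =
      ENNReal.ofReal (2 * Real.pi * Real.log (δ⁻¹ / δ)) := by
    have hc1 : DifferentiableOn ℂ (fun _ : ℂ => (1:ℂ)) (ball 0 (δ⁻¹ + 1)) := by fun_prop
    have h1 := ann_integral hc1 hδ0 hδi (lt_add_one _)
    have h2 := ann_integrable (b := δ⁻¹) hc1 hδ0 (lt_add_one _)
    simp only [Complex.one_re, mul_one] at h1 h2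
    rw [← h1, ofReal_integral_eq_lintegral_ofReal h2]
    exact Filter.Eventually.of_forall fun z => by positivity
  have hlow := area_lower ht h0 hne hd hε hεR hR2
  have hfin : ENNReal.ofReal (2 * Real.pi * Real.log (R / ε)) +
      ENNReal.ofReal (2 * Real.pi * Real.log (R / ε)) ≤
      ENNReal.ofReal (2 * Real.pi * Real.log (δ⁻¹ / δ)) := by
    calc _ ≤ _ := add_le_add (hlow.trans a1.symm.le) (hlow.trans a2.symm.le)
      _ = _ := (lintegral_union m2 hdisj).symm
      _ ≤ _ := lintegral_mono_set hsubA
      _ = _ := hup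
  have hlogR : 0 < Real.log (R / ε) := Real.log_pos ((one_lt_div hε).2 hεR)
  have hlogd : 0 < Real.log (δ⁻¹ / δ) := Real.log_pos ((one_lt_div hδ0).2 hδi)
  have hpi := Real.pi_pos
  rw [← ENNReal.ofReal_add (by positivity) (by positivity),
    ENNReal.ofReal_le_ofReal_iff (by positivity)] at hfin
  rw [Real.log_div hR0.ne' hε.ne', Real.log_div (by positivity) hδ0.ne', Real.log_inv,
    hδ, Real.log_mul hκ0.ne' hε.ne'] at hfin
  have h5 : Real.log R + Real.log κ ≤ 0 := by
    have : 2 * Real.pi * (2 * (Real.log R + Real.log κ)) ≤ 0 := by linarith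
    by_contra! h
    have : 0 < 2 * Real.pi * (2 * (Real.log R + Real.log κ)) := by positivity
    linarith
  have h6 := Real.log_lt_log (inv_pos.2 hκ0) hR1
  rw [Real.log_inv] at h6
  linarith


lemma exists_sqrt {h : ℂ → ℂ} (hh : DifferentiableOn ℂ h (ball 0 1)) (h0 : h 0 = 1)
    (hne : ∀ z ∈ ball (0:ℂ) 1, h z ≠ 0) :
    ∃ s : ℂ → ℂ, DifferentiableOn ℂ s (ball 0 1) ∧ s 0 = 1 ∧
      ∀ z ∈ ball (0:ℂ) 1, s z ^ 2 = h z := by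
  have hd : DifferentiableOn ℂ (fun z => deriv h z / h z) (ball 0 1) :=
    (hh.deriv isOpen_ball).div hh hne
  obtain ⟨L, hL⟩ := hd.isExactOn_ball.with_val_at 0 0
  obtain ⟨hL0, hL⟩ := hL
  have hL' : ∀ z ∈ ball (0:ℂ) 1, HasDerivAt L (deriv h z / h z) z := fun z hz => by
    exact hL z hz
  have hLd : DifferentiableOn ℂ L (ball 0 1) := fun z hz =>
    (hL' z hz).differentiableAt.differentiableWithinAt
  have hm0 : (0:ℂ) ∈ ball (0:ℂ) 1 := by simp
  have key : ∀ z ∈ ball (0:ℂ) 1, h z * Complex.exp (-L z) = 1 := by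
    intro z hz
    have hG : ∀ z ∈ ball (0:ℂ) 1, HasDerivAt (fun z => h z * Complex.exp (-L z)) 0 z := by
      intro z hz
      have h1 := (hh.differentiableAt (isOpen_ball.mem_nhds hz)).hasDerivAt
      have h2 := h1.mul (hL' z hz).neg.cexp
      refine h2.congr_deriv ?_
      have := hne z hz
      try simp only [Pi.neg_apply]
      field_simp
      ring
    have := (convex_ball (0:ℂ) 1).is_const_of_fderivWithin_eq_zero (𝕜 := ℂ)
      (f := fun z => h z * Complex.exp (-L z))
      (fun z hz => (hG z hz).differentiableAt.differentiableWithinAt)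
      (fun z hz => by
        rw [fderivWithin_of_isOpen isOpen_ball hz, (hG z hz).hasFDerivAt.fderiv]
        ext; simp) hz hm0
    rw [this]; simp [h0, hL0]
  refine ⟨fun z => Complex.exp (L z / 2), by fun_prop, by simp [hL0], fun z hz => ?_⟩
  have hk := key z hz
  rw [Complex.exp_neg] at hk
  have : h z = Complex.exp (L z) := by
    field_simp at hk; exact hk
  rw [this, ← Complex.exp_nat_mul]; congr 1; push_cast; ring

lemma koebe0 {F : ℂ → ℂ} (hF : DifferentiableOn ℂ F (ball 0 1)) (hinj : InjOn F (ball 0 1))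
    {w : ℂ} (hw : ∀ z ∈ ball (0:ℂ) 1, F z ≠ w) : ‖deriv F 0‖ ≤ 4 * ‖F 0 - w‖ := by
  have hm0 : (0:ℂ) ∈ ball (0:ℂ) 1 := by simp
  have hb : F 0 - w ≠ 0 := sub_ne_zero.2 (hw 0 hm0)
  set h : ℂ → ℂ := fun z => (F z - w) / (F 0 - w) with hh
  have hhd : DifferentiableOn ℂ h (ball 0 1) := (hF.sub_const w).div_const _
  have hhne : ∀ z ∈ ball (0:ℂ) 1, h z ≠ 0 := fun z hz =>
    div_ne_zero (sub_ne_zero.2 (hw z hz)) hb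
  have hhinj : InjOn h (ball 0 1) := by
    intro z hz z' hz' he
    apply hinj hz hz'
    simp only [hh] at he
    field_simp at he
    simpa using he
  obtain ⟨s, hs, hs0, hs2⟩ := exists_sqrt hhd (div_self hb) hhne
  have hsne : ∀ z ∈ ball (0:ℂ) 1, s z ≠ 0 := fun z hz he => by
    apply hhne z hz; rw [← hs2 z hz, he]; simp
  have hss : ∀ z ∈ ball (0:ℂ) 1, ∀ z' ∈ ball (0:ℂ) 1, s z + s z' ≠ 0 := by
    intro z hz z' hz' he
    have h1 : s z = - s z' := eq_neg_of_add_eq_zero_left he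
    have h2 : z = z' := hhinj hz hz' (by rw [← hs2 z hz, ← hs2 z' hz', h1]; ring)
    rw [h2] at he
    apply hsne z' hz'
    linear_combination he / 2
  have h1s : ∀ z ∈ ball (0:ℂ) 1, 1 + s z ≠ 0 := fun z hz => by
    have := hss 0 hm0 z hz; rwa [hs0] at this
  set t : ℂ → ℂ := fun z => (1 - s z) / (1 + s z) with ht
  have htd : DifferentiableOn ℂ t (ball 0 1) :=
    (hs.const_sub 1).div (hs.const_add 1) h1s
  have key := bieb_eil htd (by simp [ht, hs0]) (by
      intro z hz z' hz' he
      have a := h1s z hz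
      have b := h1s z' hz'
      simp only [ht] at he
      rw [div_eq_div_iff a b] at he
      have : s z = s z' := by linear_combination -he / 2
      exact hhinj hz hz' (by rw [← hs2 z hz, ← hs2 z' hz', this])) (by
      intro z hz z' hz' he
      have a := h1s z hz
      have b := h1s z' hz'
      simp only [ht] at he
      rw [div_mul_div_comm, div_eq_one_iff_eq (mul_ne_zero a b)] at he
      apply hss z hz z' hz'
      linear_combination -he / 2)
  have hsD : HasDerivAt s (deriv s 0) 0 :=
    (hs.differentiableAt (isOpen_ball.mem_nhds hm0)).hasDerivAt
  have hFD : HasDerivAt F (deriv F 0) 0 :=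
    (hF.differentiableAt (isOpen_ball.mem_nhds hm0)).hasDerivAt
  have e1 : deriv F 0 / (F 0 - w) = 2 * deriv s 0 := by
    have h1 : HasDerivAt h (deriv F 0 / (F 0 - w)) 0 := (hFD.sub_const w).div_const _
    have h2 : HasDerivAt (fun z => s z ^ 2) (2 * deriv s 0) 0 := by
      have := hsD.pow 2
      exact this.congr_deriv (by simp [hs0])
    have h3 : h =ᶠ[nhds 0] fun z => s z ^ 2 := by
      filter_upwards [isOpen_ball.mem_nhds hm0] with z hz using (hs2 z hz).symm
    exact h1.unique (h2.congr_of_eventuallyEq h3)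
  have e2 : deriv t 0 = - deriv s 0 / 2 := by
    have := ((hsD.const_sub 1).div (hsD.const_add 1) (h1s 0 hm0)).deriv
    rw [hs0] at this
    have h' : deriv t 0 = _ := this
    rw [h']; ring
  have e3 : deriv F 0 = -4 * deriv t 0 * (F 0 - w) := by
    rw [e2]; rw [div_eq_iff hb] at e1; rw [e1]; ring
  rw [e3, norm_mul, norm_mul]
  have : ‖(-4 : ℂ)‖ = 4 := by simp
  rw [this]
  nlinarith [norm_nonneg (F 0 - w)]

lemma koebe {f : ℂ → ℂ} (hf : DifferentiableOn ℂ f (ball 0 1)) (hinj : InjOn f (ball 0 1))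
    {w : ℂ} (hw : ∀ z ∈ ball (0:ℂ) 1, f z ≠ w) {a : ℂ} (ha : a ∈ ball (0:ℂ) 1) :
    (1 - ‖a‖ ^ 2) * ‖deriv f a‖ ≤ 4 * ‖f a - w‖ := by
  have ha1 : ‖a‖ < 1 := by simpa using ha
  have hm0 : (0:ℂ) ∈ ball (0:ℂ) 1 := by simp
  have hden : ∀ z ∈ ball (0:ℂ) 1, 1 + (starRingEnd ℂ) a * z ≠ 0 := by
    intro z hz he
    have hz1 : ‖z‖ < 1 := by simpa using hz
    have h1 : (starRingEnd ℂ) a * z = -1 := by linear_combination he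
    have h2 := congrArg norm h1
    rw [norm_mul, RCLike.norm_conj, norm_neg, norm_one] at h2
    nlinarith [norm_nonneg a, norm_nonneg z]
  set M : ℂ → ℂ := fun z => (z + a) / (1 + (starRingEnd ℂ) a * z) with hM
  have hMb : ∀ z ∈ ball (0:ℂ) 1, M z ∈ ball (0:ℂ) 1 := by
    intro z hz
    have hz1 : ‖z‖ < 1 := by simpa using hz
    rw [mem_ball_zero_iff, hM]
    simp only [norm_div]
    rw [div_lt_one (norm_pos_iff.2 (hden z hz))]
    apply lt_of_pow_lt_pow_left₀ 2 (norm_nonneg _)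
    have hz2 : z.re * z.re + z.im * z.im < 1 := by
      rw [← Complex.normSq_apply, Complex.normSq_eq_norm_sq]; nlinarith [norm_nonneg z]
    have ha2 : a.re * a.re + a.im * a.im < 1 := by
      rw [← Complex.normSq_apply, Complex.normSq_eq_norm_sq]; nlinarith [norm_nonneg a]
    rw [← Complex.normSq_eq_norm_sq, ← Complex.normSq_eq_norm_sq, Complex.normSq_apply,
      Complex.normSq_apply]
    simp
    nlinarith [mul_pos (sub_pos.2 hz2) (sub_pos.2 ha2)]
  have hMd : ∀ z ∈ ball (0:ℂ) 1, DifferentiableAt ℂ M z := by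
    intro z hz
    exact DifferentiableAt.div (by fun_prop) (by fun_prop) (hden z hz)
  have hn : (starRingEnd ℂ) a * a = ((‖a‖ ^ 2 : ℝ) : ℂ) := by
    rw [mul_comm, Complex.mul_conj, Complex.normSq_eq_norm_sq]
  have hpos : 0 < 1 - ‖a‖ ^ 2 := by nlinarith [norm_nonneg a]
  have hpos' : 1 - (starRingEnd ℂ) a * a ≠ 0 := by
    rw [hn]; exact_mod_cast hpos.ne'
  have hMinj : InjOn M (ball 0 1) := by
    intro z hz z' hz' he
    simp only [hM] at he
    rw [div_eq_div_iff (hden z hz) (hden z' hz')] at he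
    have : (1 - (starRingEnd ℂ) a * a) * (z - z') = 0 := by linear_combination he
    exact sub_eq_zero.1 ((mul_eq_zero.1 this).resolve_left hpos')
  have hM0 : M 0 = a := by simp [hM]
  have hMder : HasDerivAt M ((1 - ‖a‖ ^ 2 : ℝ) : ℂ) 0 := by
    have h1 : HasDerivAt (fun z : ℂ => z + a) 1 0 := (hasDerivAt_id 0).add_const a
    have h2 : HasDerivAt (fun z : ℂ => 1 + (starRingEnd ℂ) a * z) ((starRingEnd ℂ) a) 0 := by
      simpa using ((hasDerivAt_id (0:ℂ)).const_mul ((starRingEnd ℂ) a)).const_add 1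
    have h3 := h1.div h2 (hden 0 hm0)
    refine h3.congr_deriv ?_
    have := hn
    push_cast at this
    push_cast
    rw [← this]; simp; ring
  have hfa : HasDerivAt f (deriv f a) (M 0) := by
    rw [hM0]; exact (hf.differentiableAt (isOpen_ball.mem_nhds ha)).hasDerivAt
  have hcomp := (hfa.comp 0 hMder).deriv
  have := koebe0 (F := f ∘ M) (w := w) (fun z hz =>
      ((hf.differentiableAt (isOpen_ball.mem_nhds (hMb z hz))).comp z
        (hMd z hz)).differentiableWithinAt)
    (hinj.comp hMinj hMb) (fun z hz => hw _ (hMb z hz))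
  rw [hcomp, norm_mul, Complex.norm_real, Real.norm_of_nonneg hpos.le, Function.comp, hM0] at this
  linarith


lemma phi_contDiffAt {f : ℂ → ℂ} {φ : ℂ → ℝ} (hf : DifferentiableOn ℂ f (ball (0:ℂ) 1))
    (hφ : ∀ ζ ∈ ball (0:ℂ) 1,
      Real.exp (φ (f ζ)) = 4 / ((1 - ‖ζ‖ ^ 2) ^ 2 * ‖deriv f ζ‖ ^ 2))
    {a : ℂ} (ha : a ∈ ball (0:ℂ) 1) : ContDiffAt ℝ 1 φ (f a) := by
  have ha1 : ‖a‖ < 1 := by simpa using ha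
  have hd : deriv f a ≠ 0 := by
    intro h
    have := hφ a ha
    rw [h] at this
    simp at this
  have hpos : 1 - ‖a‖ ^ 2 ≠ 0 := by
    have : 0 < 1 - ‖a‖ ^ 2 := by nlinarith [norm_nonneg a]
    exact this.ne'
  have hball : ball (0:ℂ) 1 ∈ nhds a := isOpen_ball.mem_nhds ha
  have han : AnalyticAt ℂ f a := hf.analyticAt hball
  have hs : HasStrictDerivAt f (deriv f a) a := han.hasStrictDerivAt
  have hs' := hs.hasStrictFDerivAt_equiv hd
  have hcd : ContDiffAt ℂ 1 f a := han.contDiffAt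
  have hginv := hcd.to_localInverse hs'.hasFDerivAt one_ne_zero
  set g := hcd.localInverse hs'.hasFDerivAt one_ne_zero with hg
  have hga : g (f a) = a := hcd.localInverse_apply_image hs'.hasFDerivAt one_ne_zero
  have hright : ∀ᶠ w in nhds (f a), f (g w) = w :=
    (hcd.toOpenPartialHomeomorph f hs'.hasFDerivAt one_ne_zero).eventually_right_inverse
      (hcd.image_mem_toOpenPartialHomeomorph_target hs'.hasFDerivAt one_ne_zero)
  have hgc : Filter.Tendsto g (nhds (f a)) (nhds a) := by
    have := hginv.continuousAt.tendsto; rwa [hga] at this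
  have hΦ : ContDiffAt ℝ 1
      (fun ζ : ℂ => Real.log (4 / ((1 - ‖ζ‖ ^ 2) ^ 2 * ‖deriv f ζ‖ ^ 2))) (g (f a)) := by
    rw [hga]
    have h1 : ContDiffAt ℝ 1 (deriv f) a := (han.deriv.contDiffAt (n := 1)).restrict_scalars ℝ
    have h2 : ContDiffAt ℝ 1 (fun ζ : ℂ => ‖deriv f ζ‖ ^ 2) a := h1.norm_sq ℝ
    have h3 : ContDiffAt ℝ 1 (fun ζ : ℂ => (1 - ‖ζ‖ ^ 2) ^ 2) a :=
      (contDiffAt_const.sub (contDiffAt_id.norm_sq ℝ)).pow 2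
    have hne : (1 - ‖a‖ ^ 2) ^ 2 * ‖deriv f a‖ ^ 2 ≠ 0 := by
      have := norm_ne_zero_iff.2 hd
      positivity
    exact (contDiffAt_const.div (h3.mul h2) hne).log (div_ne_zero (by norm_num) hne)
  have hcomp := hΦ.comp (f a) (hginv.restrict_scalars ℝ)
  refine hcomp.congr_of_eventuallyEq ?_
  filter_upwards [hright, hgc hball] with w hw1 hw2
  have := hφ (g w) hw2
  rw [hw1] at this
  simp only [Function.comp]
  rw [← this, Real.log_exp]

lemma epsteinMap_continuousAt {φ : ℂ → ℝ} {z : ℂ} (h : ContDiffAt ℝ 1 φ z) :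
    ContinuousAt (epsteinMap φ) z := by
  have h1 : ContinuousAt (fderiv ℝ φ) z := h.continuousAt_fderiv (by simp)
  have h2 : ContinuousAt φ z := h.continuousAt
  have hW : ContinuousAt (wirtingerBar φ) z := by
    unfold wirtingerBar; fun_prop
  have hP : ContinuousAt (epsteinPsi φ) z := by
    unfold epsteinPsi; fun_prop
  have hX : ContinuousAt (epsteinXi φ) z := by
    unfold epsteinXi
    apply ContinuousAt.div (by fun_prop) (by fun_prop)
    positivity
  unfold epsteinMap
  fun_prop

lemma toEuc_dist (p q : ℂ × ℝ) :
    dist (toEuc p) (toEuc q) = Real.sqrt (‖p.1 - q.1‖ ^ 2 + (p.2 - q.2) ^ 2) := by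
  rw [WithLp.prod_dist_eq_of_L2]
  simp [toEuc, dist_eq_norm]

lemma exp_bound {f : ℂ → ℂ} {φ : ℂ → ℝ} (hf : DifferentiableOn ℂ f (ball (0:ℂ) 1))
    (hinj : InjOn f (ball (0:ℂ) 1))
    (hφ : ∀ ζ ∈ ball (0:ℂ) 1,
      Real.exp (φ (f ζ)) = 4 / ((1 - ‖ζ‖ ^ 2) ^ 2 * ‖deriv f ζ‖ ^ 2))
    {a : ℂ} (ha : a ∈ ball (0:ℂ) 1) {w : ℂ} (hw : ∀ z ∈ ball (0:ℂ) 1, f z ≠ w) :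
    Real.exp (-(φ (f a)) / 2) ≤ 2 * dist (f a) w := by
  have ha1 : ‖a‖ < 1 := by simpa using ha
  have hpos : 0 < 1 - ‖a‖ ^ 2 := by nlinarith [norm_nonneg a]
  have hk := koebe hf hinj hw ha
  have h1 : Real.exp (-(φ (f a)) / 2) ^ 2 = ((1 - ‖a‖ ^ 2) * ‖deriv f a‖ / 2) ^ 2 := by
    rw [← Real.exp_nat_mul]
    rw [show ((2:ℕ):ℝ) * (-(φ (f a)) / 2) = -(φ (f a)) by push_cast; ring, Real.exp_neg,
      hφ a ha, inv_div]
    ring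
  have h2 := (sq_eq_sq₀ (Real.exp_pos _).le (by positivity)).1 h1
  rw [h2, dist_eq_norm]
  linarith

lemma xi_facts (φ : ℂ → ℝ) (z : ℂ) :
    0 ≤ epsteinXi φ z ∧ epsteinXi φ z * (1 + ‖epsteinPsi φ z‖ ^ 2) =
      2 * Real.exp (-(φ z) / 2) ∧
    epsteinXi φ z ≤ 2 * Real.exp (-(φ z) / 2) ∧
    epsteinXi φ z ^ 2 * (1 + ‖epsteinPsi φ z‖ ^ 2) ≤ (2 * Real.exp (-(φ z) / 2)) ^ 2 := by
  have h0 : 0 ≤ epsteinXi φ z := by unfold epsteinXi; positivity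
  have h1 : epsteinXi φ z * (1 + ‖epsteinPsi φ z‖ ^ 2) = 2 * Real.exp (-(φ z) / 2) := by
    unfold epsteinXi; field_simp
  have h2 : epsteinXi φ z ≤ 2 * Real.exp (-(φ z) / 2) := by
    rw [← h1]; nlinarith [sq_nonneg ‖epsteinPsi φ z‖]
  refine ⟨h0, h1, h2, ?_⟩
  nlinarith [Real.exp_pos (-(φ z) / 2)]

/-- The Epstein–Poincaré map of a Jordan domain extends continuously by the identity to the
boundary curve `γ`, and `(√5-2) d(z,γ) ≤ d(Ep_Ω z, γ) ≤ 5 d(z,γ)` where distances in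
`ℝ³ = ℂ × ℝ` are Euclidean and `γ` sits in `ℂ × {0}`. -/
theorem epstein_boundary_behavior
    (Ω γ : Set ℂ) (f : ℂ → ℂ) (φ : ℂ → ℝ)
    (hγ : IsJordanCurve γ) (hfr : frontier Ω = γ) (hΩ : IsOpen Ω)
    (hf : DifferentiableOn ℂ f (ball (0:ℂ) 1))
    (hinj : InjOn f (ball (0:ℂ) 1))
    (him : f '' ball (0:ℂ) 1 = Ω)
    (hφ : ∀ ζ ∈ ball (0:ℂ) 1,
      Real.exp (φ (f ζ)) = 4 / ((1 - ‖ζ‖ ^ 2) ^ 2 * ‖deriv f ζ‖ ^ 2)) :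
    (∃ E : ℂ → ℂ × ℝ, ContinuousOn E (closure Ω) ∧
      (∀ z ∈ Ω, E z = epsteinMap φ z) ∧ ∀ z ∈ γ, E z = (z, 0)) ∧
    ∀ z ∈ Ω,
      (Real.sqrt 5 - 2) * infDist z γ ≤
          infDist (toEuc (epsteinMap φ z)) ((fun w => toEuc (w, (0:ℝ))) '' γ) ∧
        infDist (toEuc (epsteinMap φ z)) ((fun w => toEuc (w, (0:ℝ))) '' γ) ≤
          5 * infDist z γ := by
  have hγΩ : ∀ w ∈ γ, w ∉ Ω := by
    intro w hw hw'
    rw [← hfr, hΩ.frontier_eq] at hw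
    exact hw.2 hw'
  have hbd : ∀ z ∈ Ω, ∀ w, w ∉ Ω → Real.exp (-(φ z) / 2) ≤ 2 * dist z w := by
    intro z hz w hw
    rw [← him] at hz
    obtain ⟨a, ha, rfl⟩ := hz
    refine exp_bound hf hinj hφ ha fun y hy he => hw ?_
    rw [← him, ← he]; exact mem_image_of_mem f hy
  obtain ⟨c, hc, -, hcr⟩ := hγ
  have hcomp : IsCompact γ := by rw [← hcr]; exact isCompact_range hc
  have hne : γ.Nonempty := by rw [← hcr]; exact range_nonempty c
  refine ⟨?_, ?_⟩
  · classical
    refine ⟨fun z => if z ∈ Ω then epsteinMap φ z else (z, 0), ?_, ?_, ?_⟩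
    · intro z hz
      by_cases hzΩ : z ∈ Ω
      · apply ContinuousAt.continuousWithinAt
        have h1 : ContinuousAt (epsteinMap φ) z := by
          rw [← him] at hzΩ
          obtain ⟨a, ha, rfl⟩ := hzΩ
          exact epsteinMap_continuousAt (phi_contDiffAt hf hφ ha)
        refine h1.congr ?_
        filter_upwards [hΩ.mem_nhds hzΩ] with w hw
        rw [if_pos hw]
      · apply ContinuousAt.continuousWithinAt
        rw [ContinuousAt, if_neg hzΩ, tendsto_iff_dist_tendsto_zero]
        have hlim : Filter.Tendsto (fun w => 5 * dist w z) (nhds z) (nhds 0) := by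
          have : ContinuousAt (fun w => 5 * dist w z) z := by fun_prop
          simpa [ContinuousAt] using this
        refine squeeze_zero (fun _ => dist_nonneg) (fun w => ?_) hlim
        split_ifs with hw
        · have hb := hbd w hw z hzΩ
          obtain ⟨x0, x1, x2, x3⟩ := xi_facts φ w
          rw [Prod.dist_eq]
          apply max_le
          · simp only [epsteinMap]
            have h4 : ‖(epsteinXi φ w : ℂ) * epsteinPsi φ w‖ ≤ 2 * Real.exp (-(φ w) / 2) := by
              rw [norm_mul, Complex.norm_real, Real.norm_of_nonneg x0]
              refine (pow_le_pow_iff_left₀ (by positivity) (by positivity) two_ne_zero).1 ?_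
              nlinarith [sq_nonneg (epsteinXi φ w)]
            calc dist (w + (epsteinXi φ w : ℂ) * epsteinPsi φ w) z
                = ‖(w - z) + (epsteinXi φ w : ℂ) * epsteinPsi φ w‖ := by
                  rw [dist_eq_norm]; congr 1; ring
              _ ≤ ‖w - z‖ + ‖(epsteinXi φ w : ℂ) * epsteinPsi φ w‖ := norm_add_le _ _
              _ ≤ 5 * dist w z := by rw [← dist_eq_norm]; linarith
          · simp only [epsteinMap]
            rw [Real.dist_eq, sub_zero, abs_of_nonneg x0]
            linarith [dist_nonneg (x := w) (y := z)]
        · rw [Prod.dist_eq]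
          apply max_le
          · simp only; linarith [dist_nonneg (x := w) (y := z)]
          · simp
    · intro z hz; simp [hz]
    · intro z hz; simp [hγΩ z hz]
  · intro z hz
    obtain ⟨x0, x1, x2, x3⟩ := xi_facts φ z
    set r := Real.exp (-(φ z) / 2) with hr
    have hr0 : 0 < r := Real.exp_pos _
    set d := infDist z γ with hd
    have hd0 : 0 ≤ d := infDist_nonneg
    obtain ⟨w0, hw0, hdw0⟩ := hcomp.exists_infDist_eq_dist hne z
    have hrd : r ≤ 2 * d := by rw [hd, hdw0]; exact hbd z hz w0 (hγΩ w0 hw0)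
    have hnorm : ‖(epsteinMap φ z).1 - z‖ ^ 2 = epsteinXi φ z ^ 2 * ‖epsteinPsi φ z‖ ^ 2 := by
      simp only [epsteinMap, add_sub_cancel_left]
      rw [norm_mul, Complex.norm_real, Real.norm_of_nonneg x0, mul_pow]
    have hsnd : (epsteinMap φ z).2 = epsteinXi φ z := rfl
    have hne' : ((fun w => toEuc (w, (0:ℝ))) '' γ).Nonempty := hne.image _
    constructor
    · rw [le_infDist hne']
      rintro _ ⟨w, hw, rfl⟩
      have hdw : d ≤ ‖z - w‖ := by rw [← dist_eq_norm]; exact infDist_le_dist_of_mem hw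
      have t1 : dist (toEuc (epsteinMap φ z)) (toEuc (z, r)) = r := by
        rw [toEuc_dist]
        simp only [hnorm, hsnd]
        rw [Real.sqrt_eq_iff_mul_self_eq (by positivity) hr0.le]
        nlinarith
      have t2 : r + (Real.sqrt 5 - 2) * d ≤ dist (toEuc (z, r)) (toEuc (w, 0)) := by
        rw [toEuc_dist]
        apply Real.le_sqrt_of_sq_le
        simp only [sub_zero]
        have h5 : Real.sqrt 5 ^ 2 = 5 := Real.sq_sqrt (by norm_num)
        have h52 : 2 ≤ Real.sqrt 5 := by
          apply Real.le_sqrt_of_sq_le; norm_num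
        have h6 : d ^ 2 ≤ ‖z - w‖ ^ 2 := by gcongr
        have h7 : 0 ≤ (Real.sqrt 5 - 2) * d * (2 * d - r) :=
          mul_nonneg (mul_nonneg (by linarith) hd0) (by linarith)
        have h8 : Real.sqrt 5 ^ 2 * d ^ 2 = 5 * d ^ 2 := by rw [h5]
        nlinarith
      have t3 := dist_triangle_left (toEuc (z, r)) (toEuc (w, 0)) (toEuc (epsteinMap φ z))
      linarith
    · refine (infDist_le_dist_of_mem (mem_image_of_mem _ hw0)).trans ?_
      have t1 : dist (toEuc (epsteinMap φ z)) (toEuc (z, 0)) ≤ 2 * r := by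
        rw [toEuc_dist]
        simp only [hnorm, hsnd, sub_zero]
        rw [Real.sqrt_le_left (by positivity)]
        linarith
      have t2 : dist (toEuc (z, 0)) (toEuc (w0, 0)) = d := by
        rw [toEuc_dist, hd, hdw0, dist_eq_norm]
        simp
      have t3 := dist_triangle (toEuc (epsteinMap φ z)) (toEuc (z, 0)) (toEuc (w0, 0))
      linarith
end
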